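/- Let k ∈ [0,1) and let θ₁, θ₂, θ₃ ∈ (0,K) satisfy θ₁ + θ₂ + θ₃ = 2K. Then: (i) k'·sc(θ₁|k)·sc(θ₂|k)·sc(θ₃|k) = A(θ₁|k) + A(θ₂|k) + A(θ₃|k); equivalently, with m²₀ := Σ_{ℓ=1}^3 (A(θ_ℓ|k) − sc(θ_ℓ|k)), one has k'·∏_{ℓ=1}^3 sc(θ_ℓ|k) = m²₀ + Σ_{ℓ=1}^3 sc(θ_ℓ|k). (ii) For {i,j,k̂} = {1,2,3}: [A(K−θ_i|k) − sc(K−θ_i|k)] + [A(K−θ_j|k) − sc(K−θ_j|k)] − [A(θ_{k̂}|k) − sc(θ_{k̂}|k)] = sc(θ_{k̂}|k) − sc(K−θ_i|k) − sc(K−θ_j|k) − k'·sc(K−θ_i|k)·sc(K−θ_j|k)·sc(θ_{k̂}|k). -/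

import Mathlib

noncomputable section

open Complex MeasureTheory Filter Topology Asymptotics

/-! ### Jacobi elliptic functions and related special functions.

The complete elliptic integrals are defined by their classical integral formulas; the
Jacobi elliptic functions are defined through Jacobi theta functions (with nome
`q = exp (iπ K'/K)`), following the classical theta-quotient representation. -/

/-- Complete elliptic integral of the first kind `K(k)`. -/
def ellK (k : ℝ) : ℝ := ∫ t in (0:ℝ)..(Real.pi/2), 1 / Real.sqrt (1 - k^2 * Real.sin t ^ 2)

/-- Complete elliptic integral of the second kind `E(k)`. -/
def ellE (k : ℝ) : ℝ := ∫ t in (0:ℝ)..(Real.pi/2), Real.sqrt (1 - k^2 * Real.sin t ^ 2)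

/-- Complementary elliptic modulus `k' = √(1-k²)`. -/
def kprime (k : ℝ) : ℝ := Real.sqrt (1 - k^2)

/-- Complementary complete elliptic integral `K'(k) = K(k')`. -/
def ellK' (k : ℝ) : ℝ := ellK (kprime k)

/-- Modular parameter `τ = i K'/K`. -/
def ellTau (k : ℝ) : ℂ := Complex.I * (ellK' k) / (ellK k)

/-- First Jacobi theta function `θ₁(u)` (argument convention of Whittaker–Watson,
with nome determined by the modulus `k`). -/
def theta1 (u : ℂ) (k : ℝ) : ℂ :=
  -Complex.I * Complex.exp ((Real.pi : ℂ) * Complex.I * ellTau k / 4 + Complex.I * u) *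
    jacobiTheta₂ (u / (Real.pi : ℂ) + ellTau k / 2 + 1/2) (ellTau k)

/-- Second Jacobi theta function `θ₂(u)`. -/
def theta2 (u : ℂ) (k : ℝ) : ℂ :=
  Complex.exp ((Real.pi : ℂ) * Complex.I * ellTau k / 4 + Complex.I * u) *
    jacobiTheta₂ (u / (Real.pi : ℂ) + ellTau k / 2) (ellTau k)

/-- Third Jacobi theta function `θ₃(u)`. -/
def theta3 (u : ℂ) (k : ℝ) : ℂ := jacobiTheta₂ (u / (Real.pi : ℂ)) (ellTau k)

/-- Fourth Jacobi theta function `θ₄(u)`. -/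
def theta4 (u : ℂ) (k : ℝ) : ℂ := jacobiTheta₂ (u / (Real.pi : ℂ) + 1/2) (ellTau k)

/-- Jacobi elliptic function `sn(u|k)`, via the theta-quotient representation. -/
def snC (u : ℂ) (k : ℝ) : ℂ :=
  (theta3 0 k * theta1 (u / (theta3 0 k)^2) k) / (theta2 0 k * theta4 (u / (theta3 0 k)^2) k)

/-- Jacobi elliptic function `cn(u|k)`. -/
def cnC (u : ℂ) (k : ℝ) : ℂ :=
  (theta4 0 k * theta2 (u / (theta3 0 k)^2) k) / (theta2 0 k * theta4 (u / (theta3 0 k)^2) k)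

/-- Jacobi elliptic function `dn(u|k)`. -/
def dnC (u : ℂ) (k : ℝ) : ℂ :=
  (theta4 0 k * theta3 (u / (theta3 0 k)^2) k) / (theta3 0 k * theta4 (u / (theta3 0 k)^2) k)

/-- Jacobi elliptic function `sc = sn/cn`. -/
def scC (u : ℂ) (k : ℝ) : ℂ := snC u k / cnC u k

/-- Jacobi elliptic function `dc = dn/cn`. -/
def dcC (u : ℂ) (k : ℝ) : ℂ := dnC u k / cnC u k

/-- Jacobi elliptic function `nd = 1/dn`. -/
def ndC (u : ℂ) (k : ℝ) : ℂ := 1 / dnC u k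

/-- Jacobi elliptic function `ns = 1/sn`. -/
def nsC (u : ℂ) (k : ℝ) : ℂ := 1 / snC u k

/-- `Dc(u|k) = ∫₀ᵘ dc²(v|k) dv` (integral along the straight segment from `0` to `u`;
since `dc²` has no residues this coincides with the meromorphic primitive). -/
def DcInt (u : ℂ) (k : ℝ) : ℂ := ∫ t in (0:ℝ)..1, u * (dcC ((t:ℂ) * u) k)^2

/-- The function `A(u|k) = (1/k')·(Dc(u|k) + ((E-K)/K)·u)`. -/
def AJ (u : ℂ) (k : ℝ) : ℂ :=
  (1 / (kprime k : ℂ)) * (DcInt u k + (((ellE k - ellK k) / ellK k : ℝ) : ℂ) * u)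

/-- The function `H(u|k) = (-i k' K'/π)·A(iu/2 | k')`. -/
def HJ (u : ℂ) (k : ℝ) : ℂ :=
  (-Complex.I * (kprime k : ℂ) * (ellK' k : ℂ) / (Real.pi : ℂ)) * AJ (Complex.I * u / 2) (kprime k)

/-- Rescaled angle `θ = (2K(k)/π)·θ̄`. -/
def thetaK (k t : ℝ) : ℝ := 2 * ellK k / Real.pi * t

/-- Real value of `sc` at a real argument. -/
def scR (u k : ℝ) : ℝ := (scC u k).re

/-- Real value of `H` at a real argument. -/
def HR (u k : ℝ) : ℝ := (HJ u k).re

/-! ### STATEMENT 18: star-triangle identities for the weights. -/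


structure IsJac (k : ℝ) (s c d : ℝ → ℝ) : Prop where
  ds : ∀ u, HasDerivAt s (c u * d u) u
  dc : ∀ u, HasDerivAt c (-(s u * d u)) u
  dd : ∀ u, HasDerivAt d (-(k^2 * s u * c u)) u
  s0 : s 0 = 0
  c0 : c 0 = 1
  d0 : d 0 = 1
  sc : ∀ u, c u ^ 2 = 1 - s u ^ 2
  sd : ∀ u, d u ^ 2 = 1 - k ^ 2 * s u ^ 2
  dpos : ∀ u, 0 < d u
  k0 : 0 < k
  k1 : k < 1

namespace IsJac
variable {k : ℝ} {s c d : ℝ → ℝ}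

lemma ks_lt (h : IsJac k s c d) (u : ℝ) : k ^ 2 * s u ^ 2 < 1 := by
  have := h.sd u
  have := h.dpos u
  nlinarith [sq_pos_of_pos (h.dpos u)]

lemma s_le (h : IsJac k s c d) (u : ℝ) : s u ^ 2 ≤ 1 := by
  have := h.sc u
  nlinarith [sq_nonneg (c u)]

lemma delta_pos (h : IsJac k s c d) (u v : ℝ) : 0 < 1 - k ^ 2 * s u ^ 2 * s v ^ 2 := by
  have h1 := h.ks_lt u
  have h2 := h.s_le v
  have h3 : 0 ≤ k ^ 2 * s u ^ 2 := by positivity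
  nlinarith [sq_nonneg (s v)]

/-- derivative along `u + v = w` -/
lemma const_aux {N D N' D' : ℝ → ℝ} (hN : ∀ u, HasDerivAt N (N' u) u)
    (hD : ∀ u, HasDerivAt D (D' u) u) (hD0 : ∀ u, D u ≠ 0)
    (h : ∀ u, N' u * D u - N u * D' u = 0) (a b : ℝ) : N a / D a = N b / D b := by
  have hq : ∀ u, HasDerivAt (fun x => N x / D x) 0 u := by
    intro u
    have := (hN u).div (hD u) (hD0 u)
    rw [h u, zero_div] at this
    exact this
  exact is_const_of_deriv_eq_zero (f := fun x => N x / D x)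
    (fun u => (hq u).differentiableAt) (fun u => (hq u).deriv) a b

lemma flip {f : ℝ → ℝ} {f' : ℝ → ℝ} (hf : ∀ u, HasDerivAt f (f' u) u) (w u : ℝ) :
    HasDerivAt (fun x => f (w - x)) (- f' (w - u)) u := by
  have := (hf (w - u)).comp u ((hasDerivAt_id u).const_sub w)
  exact this.congr_deriv (by ring)

lemma dDelta (h : IsJac k s c d) (w u : ℝ) :
    HasDerivAt (fun u => 1 - k ^ 2 * s u ^ 2 * s (w - u) ^ 2)
      (- (2 * k ^ 2 * s u * s (w-u) * (c u * d u * s (w-u) - s u * c (w-u) * d (w-u)))) u := by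
  have := ((((h.ds u).pow 2).const_mul (k^2)).mul ((flip h.ds w u).pow 2)).const_sub 1
  refine (this.congr_deriv ?_)
  simp only [Pi.pow_apply]
  push_cast
  ring

lemma alg_s (k s1 c1 d1 s2 c2 d2 : ℝ) (e1 : c1 ^ 2 = 1 - s1 ^ 2) (e2 : c2 ^ 2 = 1 - s2 ^ 2)
    (e3 : d1 ^ 2 = 1 - k ^ 2 * s1 ^ 2) (e4 : d2 ^ 2 = 1 - k ^ 2 * s2 ^ 2) :
    (c1*d1*c2*d2+s1*(s2*d2)*d2+s1*c2*(k^2*s2*c2)+(-(c2*d2))*c1*d1+s2*(-(s1*d1))*d1+s2*c1*(-(k^2*s1*c1)))*(1 - k^2*s1^2*s2^2) - (s1*c2*d2+s2*c1*d1)*(-(2*k^2*s1*s2*(c1*d1*s2-s1*c2*d2))) = 0 := by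
  linear_combination ((-1)*k^2*s1*s2 + (2)*k^2*s1*d1^2*s2^3 + k^4*s1^3*s2^3)*e1 + (k^2*s1*s2 + (-2)*k^2*s1^3*s2*d2^2 + (-1)*k^4*s1^3*s2^3)*e2 + ((-1)*s1*s2 + (2)*k^2*s1*s2^3 + (-1)*k^2*s1^3*s2^3)*e3 + (s1*s2 + (-2)*k^2*s1^3*s2 + k^2*s1^3*s2^3)*e4

lemma alg_c (k s1 c1 d1 s2 c2 d2 : ℝ) (e1 : c1 ^ 2 = 1 - s1 ^ 2) (e2 : c2 ^ 2 = 1 - s2 ^ 2)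
    (e3 : d1 ^ 2 = 1 - k ^ 2 * s1 ^ 2) (e4 : d2 ^ 2 = 1 - k ^ 2 * s2 ^ 2) :
    ((-(s1*d1))*c2+c1*(s2*d2)-(c1*d1*s2*d1*d2+s1*(-(c2*d2))*d1*d2+s1*s2*(-(k^2*s1*c1))*d2+s1*s2*d1*(k^2*s2*c2)))*(1 - k^2*s1^2*s2^2) - (c1*c2-s1*s2*d1*d2)*(-(2*k^2*s1*s2*(c1*d1*s2-s1*c2*d2))) = 0 := by
  linear_combination ((2)*k^2*s1*d1*s2^2*c2)*e1 + ((-2)*k^2*s1^2*c1*s2*d2)*e2 + ((-1)*c1*s2*d2 + (-1)*k^2*s1^2*c1*s2^3*d2)*e3 + (s1*d1*c2 + k^2*s1^3*d1*s2^2*c2)*e4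

lemma alg_d (k s1 c1 d1 s2 c2 d2 : ℝ) (e1 : c1 ^ 2 = 1 - s1 ^ 2) (e2 : c2 ^ 2 = 1 - s2 ^ 2)
    (e3 : d1 ^ 2 = 1 - k ^ 2 * s1 ^ 2) (e4 : d2 ^ 2 = 1 - k ^ 2 * s2 ^ 2) :
    ((-(k^2*s1*c1))*d2+d1*(k^2*s2*c2)-k^2*(c1*d1*s2*c1*c2+s1*(-(c2*d2))*c1*c2+s1*s2*(-(s1*d1))*c2+s1*s2*c1*(s2*d2)))*(1 - k^2*s1^2*s2^2) - (d1*d2-k^2*s1*s2*c1*c2)*(-(2*k^2*s1*s2*(c1*d1*s2-s1*c2*d2))) = 0 := by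
  linear_combination ((-1)*k^2*d1*s2*c2 + (-1)*k^4*s1^2*d1*s2^3*c2)*e1 + (k^2*s1*c1*d2 + k^4*s1^3*c1*s2^2*d2)*e2 + ((2)*k^2*s1*c1*s2^2*d2)*e3 + ((-2)*k^2*s1^2*d1*s2*c2)*e4

lemma alg_diff (k s1 c1 d1 s2 c2 d2 : ℝ) (e1 : c1 ^ 2 = 1 - s1 ^ 2) (e2 : c2 ^ 2 = 1 - s2 ^ 2)
    (e3 : d1 ^ 2 = 1 - k ^ 2 * s1 ^ 2) (e4 : d2 ^ 2 = 1 - k ^ 2 * s2 ^ 2) :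
    (s1*c2*d2+s2*c1*d1)*(c1*d1*s2-s1*c2*d2) = (s2^2-s1^2)*(1 - k^2*s1^2*s2^2) := by
  linear_combination (d1^2*s2^2)*e1 + ((-1)*s1^2*d2^2)*e2 + (s2^2 + (-1)*s1^2*s2^2)*e3 + ((-1)*s1^2 + s1^2*s2^2)*e4

lemma add_s (h : IsJac k s c d) (u v : ℝ) :
    s (u + v) * (1 - k ^ 2 * s u ^ 2 * s v ^ 2) = s u * c v * d v + s v * c u * d u := by
  have key := const_aux (N := fun x => s x * c (u + v - x) * d (u + v - x) + s (u + v - x) * c x * d x)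
    (fun x => (((h.ds x).mul (flip h.dc (u+v) x)).mul (flip h.dd (u+v) x)).add
      (((flip h.ds (u+v) x).mul (h.dc x)).mul (h.dd x))) (h.dDelta (u + v))
    (fun x => (h.delta_pos _ _).ne') (by
      intro x
      have e1 := h.sc x
      have e2 := h.sc (u+v-x)
      have e3 := h.sd x
      have e4 := h.sd (u+v-x)
      have := alg_s k (s x) (c x) (d x) (s (u+v-x)) (c (u+v-x)) (d (u+v-x)) e1 e2 e3 e4
      simp only [Pi.mul_apply]
      linear_combination this) u (u+v)
  simp only [sub_self, h.s0, h.c0, h.d0, add_sub_cancel_left] at key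
  rw [div_eq_iff (h.delta_pos _ _).ne'] at key
  rw [key]; simp

lemma add_c (h : IsJac k s c d) (u v : ℝ) :
    c (u + v) * (1 - k ^ 2 * s u ^ 2 * s v ^ 2) = c u * c v - s u * s v * d u * d v := by
  have key := const_aux (N := fun x => c x * c (u + v - x) - s x * s (u + v - x) * d x * d (u+v-x))
    (fun x => ((h.dc x).mul (flip h.dc (u+v) x)).sub
      ((((h.ds x).mul (flip h.ds (u+v) x)).mul (h.dd x)).mul (flip h.dd (u+v) x))) (h.dDelta (u + v))
    (fun x => (h.delta_pos _ _).ne') (by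
      intro x
      have e1 := h.sc x
      have e2 := h.sc (u+v-x)
      have e3 := h.sd x
      have e4 := h.sd (u+v-x)
      have := alg_c k (s x) (c x) (d x) (s (u+v-x)) (c (u+v-x)) (d (u+v-x)) e1 e2 e3 e4
      simp only [Pi.mul_apply]
      linear_combination this) u (u+v)
  simp only [sub_self, h.s0, h.c0, h.d0, add_sub_cancel_left] at key
  rw [div_eq_iff (h.delta_pos _ _).ne'] at key
  rw [key]; simp

lemma add_d (h : IsJac k s c d) (u v : ℝ) :
    d (u + v) * (1 - k ^ 2 * s u ^ 2 * s v ^ 2) = d u * d v - k ^ 2 * s u * s v * c u * c v := by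
  have key := const_aux (N := fun x => d x * d (u + v - x) - k ^ 2 * s x * s (u + v - x) * c x * c (u+v-x))
    (fun x => ((h.dd x).mul (flip h.dd (u+v) x)).sub
      (((((h.ds x).const_mul (k^2)).mul (flip h.ds (u+v) x)).mul (h.dc x)).mul (flip h.dc (u+v) x))) (h.dDelta (u + v))
    (fun x => (h.delta_pos _ _).ne') (by
      intro x
      have e1 := h.sc x
      have e2 := h.sc (u+v-x)
      have e3 := h.sd x
      have e4 := h.sd (u+v-x)
      have := alg_d k (s x) (c x) (d x) (s (u+v-x)) (c (u+v-x)) (d (u+v-x)) e1 e2 e3 e4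
      simp only [Pi.mul_apply]
      linear_combination this) u (u+v)
  simp only [sub_self, h.s0, h.c0, h.d0, add_sub_cancel_left] at key
  rw [div_eq_iff (h.delta_pos _ _).ne'] at key
  rw [key]; simp

lemma alg_aux (k s1 c1 d1 s2 c2 d2 : ℝ) (e1 : c1 ^ 2 = 1 - s1 ^ 2) (e2 : c2 ^ 2 = 1 - s2 ^ 2)
    (e3 : d1 ^ 2 = 1 - k ^ 2 * s1 ^ 2) (e4 : d2 ^ 2 = 1 - k ^ 2 * s2 ^ 2) :
    (s1 * d1 * c2 + s2 * d2 * c1) * (c1 * c2 - s1 * s2 * d1 * d2) * (1 - k ^ 2 * s1 ^ 2 * s2 ^ 2)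
      - (s1 * c2 * d2 + s2 * c1 * d1) * (d1 * d2 - k ^ 2 * s1 * s2 * c1 * c2) * c1 * c2
    = k ^ 2 * s1 * s2 * (s1 * c2 * d2 + s2 * c1 * d1) * (c1 * c2 - s1 * s2 * d1 * d2) * c1 * c2
      - (1 - k ^ 2) * s1 * s2 * (s1 * c2 * d2 + s2 * c1 * d1) * (1 - k ^ 2 * s1 ^ 2 * s2 ^ 2) := by
  linear_combination (s2*c2*d2 + (-1)*d1^2*s2*c2*d2 + (-1)*k^2*s1^2*s2^3*c2*d2 + k^2*s1^2*d1^2*s2^3*c2*d2)*e1 + (s1*c1*d1 + (-1)*s1*c1*d1*d2^2 + (-1)*k^2*s1^3*c1*d1*s2^2 + k^2*s1^3*c1*d1*s2^2*d2^2)*e2 + ((-1)*s2*c2*d2 + k^2*s1^2*s2^3*c2*d2)*e3 + ((-1)*s1*c1*d1 + k^2*s1^3*c1*d1*s2^2)*e4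

lemma diff_aux (h : IsJac k s c d) (u v : ℝ) :
    s (u + v) * (c u * d u * s v - s u * c v * d v) = s v ^ 2 - s u ^ 2 := by
  have hp := (h.delta_pos u v).ne'
  have := h.add_s u v
  apply mul_right_cancel₀ hp
  linear_combination (c u * d u * s v - s u * c v * d v) * this + alg_diff k _ _ _ _ _ _ (h.sc u) (h.sc v) (h.sd u) (h.sd v)

end IsJac

namespace IsJac
variable {k : ℝ} {s c d : ℝ → ℝ}

lemma cont_s (h : IsJac k s c d) : Continuous s :=
  continuous_iff_continuousAt.2 fun u => (h.ds u).continuousAt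
lemma cont_c (h : IsJac k s c d) : Continuous c :=
  continuous_iff_continuousAt.2 fun u => (h.dc u).continuousAt
lemma cont_d (h : IsJac k s c d) : Continuous d :=
  continuous_iff_continuousAt.2 fun u => (h.dd u).continuousAt

/-- the amplitude -/
def am (d : ℝ → ℝ) (u : ℝ) : ℝ := ∫ x in (0:ℝ)..u, d x
/-- incomplete integral of the second kind -/
def Ei (d : ℝ → ℝ) (u : ℝ) : ℝ := ∫ x in (0:ℝ)..u, d x ^ 2

lemma am_zero : am d 0 = 0 := by simp [am]
lemma Ei_zero : Ei d 0 = 0 := by simp [Ei]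

lemma d_am (h : IsJac k s c d) (u : ℝ) : HasDerivAt (am d) (d u) u :=
  intervalIntegral.integral_hasDerivAt_right (h.cont_d.intervalIntegrable _ _)
    h.cont_d.stronglyMeasurable.stronglyMeasurableAtFilter h.cont_d.continuousAt

lemma d_Ei (h : IsJac k s c d) (u : ℝ) : HasDerivAt (Ei d) (d u ^ 2) u :=
  intervalIntegral.integral_hasDerivAt_right ((h.cont_d.pow 2).intervalIntegrable _ _)
    (h.cont_d.pow 2).stronglyMeasurable.stronglyMeasurableAtFilter (h.cont_d.pow 2).continuousAt

lemma const_of {f : ℝ → ℝ} (hf : ∀ u, HasDerivAt f 0 u) (a b : ℝ) : f a = f b :=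
  is_const_of_deriv_eq_zero (fun u => (hf u).differentiableAt) (fun u => (hf u).deriv) a b

lemma am_cos_sin (h : IsJac k s c d) (u : ℝ) :
    c u = Real.cos (am d u) ∧ s u = Real.sin (am d u) := by
  have h1 : c u * Real.cos (am d u) + s u * Real.sin (am d u)
      = c 0 * Real.cos (am d 0) + s 0 * Real.sin (am d 0) := by
    refine const_of (f := fun x => c x * Real.cos (am d x) + s x * Real.sin (am d x)) ?_ u 0
    intro x
    have := ((h.dc x).mul (h.d_am x).cos).add ((h.ds x).mul (h.d_am x).sin)
    exact this.congr_deriv (by ring)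
  have h2 : s u * Real.cos (am d u) - c u * Real.sin (am d u)
      = s 0 * Real.cos (am d 0) - c 0 * Real.sin (am d 0) := by
    refine const_of (f := fun x => s x * Real.cos (am d x) - c x * Real.sin (am d x)) ?_ u 0
    intro x
    have := ((h.ds x).mul (h.d_am x).cos).sub ((h.dc x).mul (h.d_am x).sin)
    exact this.congr_deriv (by ring)
  simp only [h.s0, h.c0, am_zero, Real.cos_zero, Real.sin_zero] at h1 h2
  have h3 := Real.sin_sq_add_cos_sq (am d u)
  constructor
  · linear_combination Real.cos (am d u) * h1 - Real.sin (am d u) * h2 - c u * h3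
  · linear_combination Real.sin (am d u) * h1 + Real.cos (am d u) * h2 - s u * h3

lemma am_strictMono (h : IsJac k s c d) : StrictMono (am d) :=
  strictMono_of_hasDerivAt_pos (fun u => h.d_am u) h.dpos

lemma d_le_one (h : IsJac k s c d) (u : ℝ) : d u ≤ 1 := by
  have := h.sd u
  have := h.dpos u
  have : 0 ≤ k ^ 2 * s u ^ 2 := by positivity
  nlinarith

lemma am_le (h : IsJac k s c d) {u : ℝ} (hu : 0 ≤ u) : am d u ≤ u := by
  have : am d u ≤ ∫ x in (0:ℝ)..u, (1:ℝ) :=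
    intervalIntegral.integral_mono_on hu (h.cont_d.intervalIntegrable _ _)
      (by simp) (fun x _ => h.d_le_one x)
  simpa using this

lemma cpos_of_lt (h : IsJac k s c d) {U : ℝ} (hU : 0 < U) (hs : s U = 1)
    (hU2 : U < 5 * Real.pi / 2) {u : ℝ} (h0 : 0 ≤ u) (h1 : u < U) : 0 < c u := by
  have e : am d U = Real.pi / 2 := by
    have h2 := (h.am_cos_sin U).2
    rw [hs] at h2
    obtain ⟨n, hn⟩ := (Real.sin_eq_one_iff).1 h2.symm
    have h3 : 0 < am d U := by
      have := h.am_strictMono hU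
      rwa [am_zero] at this
    have h4 := h.am_le hU.le
    have hpi := Real.pi_pos
    have n1 : (-1 : ℝ) < n := by
      by_contra hh
      push Not at hh
      nlinarith
    have n2 : (n : ℝ) < 1 := by
      by_contra hh
      push Not at hh
      nlinarith
    have n1' : (-1 : ℤ) < n := by exact_mod_cast n1
    have n2' : n < (1 : ℤ) := by exact_mod_cast n2
    have : n = 0 := by omega
    subst this
    simpa using hn.symm
  rw [(h.am_cos_sin u).1]
  apply Real.cos_pos_of_mem_Ioo
  constructor
  · have := h.am_strictMono.monotone h0
    rw [am_zero] at this
    linarith [Real.pi_pos]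
  · rw [← e]; exact h.am_strictMono h1

lemma am_U (h : IsJac k s c d) {U : ℝ} (hU : 0 < U) (hc : c U = 0)
    (hpos : ∀ u, 0 ≤ u → u < U → 0 < c u) : am d U = Real.pi / 2 := by
  have hc' := (h.am_cos_sin U).1
  rw [hc] at hc'
  have h3 : 0 < am d U := by
    have := h.am_strictMono hU
    rwa [am_zero] at this
  rcases lt_trichotomy (am d U) (Real.pi / 2) with hlt | heq | hgt
  · have := Real.cos_pos_of_mem_Ioo (x := am d U) ⟨by linarith [Real.pi_pos], hlt⟩
    linarith
  · exact heq
  · exfalso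
    have hcont : ContinuousOn (am d) (Set.Icc 0 U) :=
      fun x _ => (h.d_am x).continuousAt.continuousWithinAt
    have := intermediate_value_Icc hU.le hcont
    obtain ⟨x, hx, hx2⟩ := this (show Real.pi / 2 ∈ _ from
      ⟨by rw [am_zero]; linarith [Real.pi_pos], hgt.le⟩)
    have hxU : x < U := by
      refine lt_of_le_of_ne hx.2 ?_
      rintro rfl
      linarith
    have h5 := hpos x hx.1 hxU
    rw [(h.am_cos_sin x).1, hx2, Real.cos_pi_div_two] at h5
    exact lt_irrefl _ h5

lemma one_sub_pos (hk0 : 0 ≤ k) (hk : k < 1) (t : ℝ) : 0 < 1 - k ^ 2 * Real.sin t ^ 2 := by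
  have h1 := Real.sin_sq_le_one t
  have : k ^ 2 < 1 := by nlinarith
  nlinarith [sq_nonneg (Real.sin t), sq_nonneg k]

lemma sqrt_eq (h : IsJac k s c d) (u : ℝ) :
    Real.sqrt (1 - k ^ 2 * Real.sin (am d u) ^ 2) = d u := by
  rw [← (h.am_cos_sin u).2, ← h.sd u, Real.sqrt_sq (h.dpos u).le]

lemma ellK_eq (h : IsJac k s c d) {U : ℝ} (hU : 0 < U) (hc : c U = 0)
    (hpos : ∀ u, 0 ≤ u → u < U → 0 < c u) : ellK k = U := by
  have h1 := intervalIntegral.integral_comp_mul_deriv (a := 0) (b := U) (f := am d) (f' := d)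
    (g := fun t => 1 / Real.sqrt (1 - k^2 * Real.sin t ^ 2)) (fun x _ => h.d_am x)
    h.cont_d.continuousOn (by
      refine Continuous.div continuous_const (by fun_prop) ?_
      intro t
      exact (Real.sqrt_pos.2 (one_sub_pos h.k0.le h.k1 t)).ne')
  rw [am_zero, h.am_U hU hc hpos] at h1
  rw [ellK, ← h1]
  have : ∀ x, ((fun t => 1 / Real.sqrt (1 - k^2 * Real.sin t ^ 2)) ∘ am d) x * d x = 1 := by
    intro x
    simp only [Function.comp, h.sqrt_eq]
    exact one_div_mul_cancel (h.dpos x).ne'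
  simp only [this]
  simp

lemma ellE_eq (h : IsJac k s c d) {U : ℝ} (hU : 0 < U) (hc : c U = 0)
    (hpos : ∀ u, 0 ≤ u → u < U → 0 < c u) : ellE k = Ei d U := by
  have h1 := intervalIntegral.integral_comp_mul_deriv (a := 0) (b := U) (f := am d) (f' := d)
    (g := fun t => Real.sqrt (1 - k^2 * Real.sin t ^ 2)) (fun x _ => h.d_am x)
    h.cont_d.continuousOn (by fun_prop)
  rw [am_zero, h.am_U hU hc hpos] at h1
  rw [ellE, ← h1]
  have : ∀ x, ((fun t => Real.sqrt (1 - k^2 * Real.sin t ^ 2)) ∘ am d) x * d x = d x ^ 2 := by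
    intro x
    simp only [Function.comp, h.sqrt_eq]
    ring
  simp only [this, Ei]

lemma Ei_add (h : IsJac k s c d) (u v : ℝ) :
    Ei d u + Ei d v - Ei d (u + v) = k ^ 2 * s u * s v * s (u + v) := by
  have h1 := const_of (f := fun x => Ei d x + Ei d (u + v - x)
      - k ^ 2 * s x * s (u + v - x) * s (u + v)) (by
    intro x
    have := ((h.d_Ei x).add (flip h.d_Ei (u+v) x)).sub
      ((((h.ds x).const_mul (k^2)).mul (flip h.ds (u+v) x)).mul_const (s (u+v)))
    refine this.congr_deriv ?_
    have e := h.diff_aux x (u + v - x)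
    rw [add_sub_cancel] at e
    rw [h.sd, h.sd]
    linear_combination (-k^2) * e) u (u + v)
  simp only [sub_self, h.s0, Ei_zero, add_sub_cancel_left] at h1
  linear_combination h1

lemma Ei_refl (h : IsJac k s c d) {U : ℝ} (hr : ∀ u, d (2 * U - u) = d u) (u : ℝ) :
    Ei d (2 * U - u) + Ei d u = 2 * Ei d U := by
  have h1 := const_of (f := fun x => Ei d (2 * U - x) + Ei d x) (by
    intro x
    have := (flip h.d_Ei (2*U) x).add (h.d_Ei x)
    refine this.congr_deriv ?_
    rw [hr]; ring) u U
  refine h1.trans ?_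
  have : 2 * U - U = U := by ring
  rw [this]; ring

lemma Dc_eq (h : IsJac k s c d) {U : ℝ} 
    (hpos : ∀ u, 0 ≤ u → u < U → 0 < c u) {u : ℝ} (h0 : 0 ≤ u) (h1 : u < U) :
    ∫ x in (0:ℝ)..u, (d x / c x) ^ 2 = u - Ei d u + s u * d u / c u := by
  have hne : ∀ x ∈ Set.uIcc 0 u, c x ≠ 0 := by
    intro x hx
    rw [Set.uIcc_of_le h0] at hx
    exact (hpos x hx.1 (hx.2.trans_lt h1)).ne'
  have := intervalIntegral.integral_eq_sub_of_hasDerivAt (a := 0) (b := u)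
    (f := fun x => x - Ei d x + s x * d x / c x) (f' := fun x => (d x / c x) ^ 2) (by
      intro x hx
      have hc := hne x hx
      have := ((hasDerivAt_id x).sub (h.d_Ei x)).add (((h.ds x).mul (h.dd x)).div (h.dc x) hc)
      refine this.congr_deriv ?_
      simp only [Pi.mul_apply]
      field_simp
      have e1 := h.sc x
      have e2 := h.sd x
      linear_combination (d x ^ 2) * e1 + (c x ^ 2) * e2 - 2 * c x ^ 2 * e2 ) (by
      apply ContinuousOn.intervalIntegrable
      exact (h.cont_d.continuousOn.div h.cont_c.continuousOn hne).pow 2)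
  rw [this]
  simp [Ei_zero, h.s0]

/-- real version of `A` -/
def AR (k U : ℝ) (s c d : ℝ → ℝ) (u : ℝ) : ℝ :=
  (1 / kprime k) * (s u * d u / c u - Ei d u + Ei d U / U * u)

lemma AR_add (h : IsJac k s c d) (U u v : ℝ) (hu : c u ≠ 0) (hv : c v ≠ 0) (huv : c (u + v) ≠ 0) :
    AR k U s c d u + AR k U s c d v - AR k U s c d (u + v)
      = - (kprime k * (s u / c u) * (s v / c v) * (s (u + v) / c (u + v))) := by
  have hk : 0 < 1 - k ^ 2 := by nlinarith [h.k0, h.k1]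
  have hkp : kprime k ≠ 0 := (Real.sqrt_pos.2 hk).ne'
  have hk2 : kprime k ^ 2 = 1 - k ^ 2 := Real.sq_sqrt hk.le
  have hE := h.Ei_add u v
  have hD := (h.delta_pos u v).ne'
  have key : s u * d u / c u + s v * d v / c v - s (u+v) * d (u+v) / c (u+v)
      = k ^ 2 * s u * s v * s (u+v) - (1 - k^2) * (s u / c u) * (s v / c v) * (s (u + v) / c (u + v)) := by
    have a1 := alg_aux k _ _ _ _ _ _ (h.sc u) (h.sc v) (h.sd u) (h.sd v)
    rw [← h.add_s, ← h.add_c, ← h.add_d] at a1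
    field_simp
    apply mul_right_cancel₀ (pow_ne_zero 2 hD)
    linear_combination a1
  unfold AR
  field_simp
  rw [hk2]
  have e : ∀ a b : ℝ, a - b = 0 → a = b := fun a b => sub_eq_zero.1
  field_simp at key
  by_cases hU : U = 0
  · subst hU
    simp only [div_zero]
    linear_combination key - c u * c v * c (u+v) * hE
  field_simp
  linear_combination U * key - U * c u * c v * c (u+v) * hE

lemma AR_refl (h : IsJac k s c d) {U : ℝ} (hU : U ≠ 0) (hrs : ∀ u, s (2 * U - u) = s u)
    (hrc : ∀ u, c (2 * U - u) = - c u) (hrd : ∀ u, d (2 * U - u) = d u) (u : ℝ) :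
    AR k U s c d (2 * U - u) = - AR k U s c d u := by
  have := h.Ei_refl hrd u
  unfold AR
  rw [hrs, hrc, hrd, div_neg]
  have h2 : Ei d U / U * (2 * U - u) = 2 * Ei d U - Ei d U / U * u := by field_simp
  rw [h2]
  linear_combination (-(1 / kprime k)) * this

end IsJac


/-- theta function with characteristic `α` -/
def Th (α : ℝ) (z τ : ℂ) : ℂ :=
  ∑' n : ℤ, cexp (2 * Real.pi * I * (n + α) * z + Real.pi * I * (n + α) ^ 2 * τ)

lemma Th_term_eq (α : ℝ) (z τ : ℂ) (n : ℤ) :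
    cexp (2 * Real.pi * I * (n + α) * z + Real.pi * I * (n + α) ^ 2 * τ)
      = cexp (2 * Real.pi * I * α * z + Real.pi * I * α ^ 2 * τ)
        * jacobiTheta₂_term n (z + α * τ) τ := by
  rw [jacobiTheta₂_term, ← Complex.exp_add]
  congr 1
  ring

lemma Th_eq (α : ℝ) (z τ : ℂ) :
    Th α z τ = cexp (2 * Real.pi * I * α * z + Real.pi * I * α ^ 2 * τ)
        * jacobiTheta₂ (z + α * τ) τ := by
  rw [Th, jacobiTheta₂, ← tsum_mul_left]
  exact tsum_congr fun n => Th_term_eq α z τ n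

lemma Th_hasSum (α : ℝ) (z : ℂ) {τ : ℂ} (hτ : 0 < τ.im) :
    HasSum (fun n : ℤ => cexp (2 * Real.pi * I * (n + α) * z + Real.pi * I * (n + α) ^ 2 * τ))
      (Th α z τ) := by
  rw [Th_eq]
  simp_rw [Th_term_eq]
  exact (hasSum_jacobiTheta₂_term _ hτ).mul_left _

lemma Th_shift (α : ℝ) (z τ : ℂ) : Th (α + 1) z τ = Th α z τ := by
  unfold Th
  rw [← (Equiv.addRight (1:ℤ)).tsum_eq
    (fun n : ℤ => cexp (2 * Real.pi * I * (n + α) * z + Real.pi * I * (n + α) ^ 2 * τ))]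
  refine tsum_congr fun n => ?_
  simp only [Equiv.coe_addRight]
  push_cast
  congr 1
  ring

lemma Th_neg (α : ℝ) (z τ : ℂ) : Th (-α) (-z) τ = Th α z τ := by
  unfold Th
  rw [← (Equiv.neg ℤ).tsum_eq
    (fun n : ℤ => cexp (2 * Real.pi * I * (n + α) * z + Real.pi * I * (n + α) ^ 2 * τ))]
  refine tsum_congr fun n => ?_
  simp only [Equiv.neg_apply]
  push_cast
  congr 1
  ring

lemma Th_add_one (α : ℝ) (z τ : ℂ) :
    Th α (z + 1) τ = cexp (2 * Real.pi * I * α) * Th α z τ := by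
  unfold Th
  rw [← tsum_mul_left]
  refine tsum_congr fun n => ?_
  rw [← Complex.exp_add]
  have : (2 * Real.pi * I * (n + α) * (z + 1) + Real.pi * I * (n + α) ^ 2 * τ : ℂ)
    = (2 * Real.pi * I * α + (2 * Real.pi * I * (n + α) * z + Real.pi * I * (n + α) ^ 2 * τ))
      + n * (2 * Real.pi * I) := by ring
  rw [this, Complex.exp_add _ ((n : ℂ) * (2 * Real.pi * I)), Complex.exp_int_mul_two_pi_mul_I, mul_one]

lemma hasSum_mul_aux {f g : ℤ → ℂ} {a b : ℂ} (h1 : HasSum f a) (h2 : HasSum g b) :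
    HasSum (fun p : ℤ × ℤ => f p.1 * g p.2) (a * b) :=
by
  have hs : Summable (fun p : ℤ × ℤ => f p.1 * g p.2) :=
    summable_mul_of_summable_norm (f := f) (g := g) h1.summable.norm h2.summable.norm
  exact HasSum.mul h1 h2 hs

lemma Th_mulsum {α β : ℝ} {X Y τ : ℂ} (hτ : 0 < τ.im) :
      HasSum (fun p : ℤ × ℤ => 
        cexp (2 * Real.pi * I * (p.1 + α) * X + Real.pi * I * (p.1 + α) ^ 2 * τ)
        * cexp (2 * Real.pi * I * (p.2 + β) * Y + Real.pi * I * (p.2 + β) ^ 2 * τ))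
        (Th α X τ * Th β Y τ) := by
  have h := hasSum_mul_aux (Th_hasSum α X hτ) (Th_hasSum β Y hτ)
  exact h

lemma Th_mul (α β : ℝ) (X Y : ℂ) {τ : ℂ} (hτ : 0 < τ.im) :
    Th α X τ * Th β Y τ
      = Th ((α + β) / 2) (X + Y) (2 * τ) * Th ((α - β) / 2) (X - Y) (2 * τ)
        + Th ((α + β + 1) / 2) (X + Y) (2 * τ) * Th ((α - β + 1) / 2) (X - Y) (2 * τ) := by
  have hτ2 : 0 < (2 * τ).im := by simpa using hτ
  have hL := Th_mulsum (α := α) (β := β) (X := X) (Y := Y) hτ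
  have hA := Th_mulsum (α := (α + β) / 2) (β := (α - β) / 2) (X := X + Y) (Y := X - Y) hτ2
  have hB := Th_mulsum (α := (α + β + 1) / 2) (β := (α - β + 1) / 2) (X := X + Y) (Y := X - Y) hτ2
  set f : ℤ × ℤ → ℂ := fun p => 
        cexp (2 * Real.pi * I * (p.1 + α) * X + Real.pi * I * (p.1 + α) ^ 2 * τ)
        * cexp (2 * Real.pi * I * (p.2 + β) * Y + Real.pi * I * (p.2 + β) ^ 2 * τ) with hf
  let e0 : ℤ × ℤ → ℤ × ℤ := fun p => (p.1 + p.2, p.1 - p.2)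
  let e1 : ℤ × ℤ → ℤ × ℤ := fun p => (p.1 + p.2 + 1, p.1 - p.2)
  have i0 : Function.Injective e0 := by
    rintro ⟨a, b⟩ ⟨a', b'⟩ h
    simp only [e0, Prod.mk.injEq] at h ⊢
    omega
  have i1 : Function.Injective e1 := by
    rintro ⟨a, b⟩ ⟨a', b'⟩ h
    simp only [e1, Prod.mk.injEq] at h ⊢
    omega
  have hA' : HasSum (f ∘ e0) (Th ((α + β) / 2) (X + Y) (2 * τ) * Th ((α - β) / 2) (X - Y) (2 * τ)) := by
    convert hA using 1
    funext p
    simp only [hf, Function.comp, e0, ← Complex.exp_add]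
    congr 1
    push_cast
    ring
  have hB' : HasSum (f ∘ e1) (Th ((α + β + 1) / 2) (X + Y) (2 * τ) * Th ((α - β + 1) / 2) (X - Y) (2 * τ)) := by
    convert hB using 1
    funext p
    simp only [hf, Function.comp, e1, ← Complex.exp_add]
    congr 1
    push_cast
    ring
  refine hL.unique ((i0.hasSum_range_iff.2 hA').add_isCompl ?_ (i1.hasSum_range_iff.2 hB'))
  constructor
  · rw [Set.disjoint_left]
    rintro x ⟨⟨a, b⟩, h⟩ ⟨⟨a1, b1⟩, h1⟩
    subst h
    simp only [e0, e1, Prod.mk.injEq] at h1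
    omega
  · rw [codisjoint_iff, Set.top_eq_univ]
    refine Set.eq_univ_iff_forall.2 ?_
    rintro ⟨n, m⟩
    rcases Int.emod_two_eq_zero_or_one (n + m) with h | h
    · left
      refine ⟨((n + m) / 2, (n - m) / 2), ?_⟩
      simp only [e0, Prod.mk.injEq]
      omega
    · right
      refine ⟨((n + m) / 2, (n - m) / 2), ?_⟩
      simp only [e1, Prod.mk.injEq]
      omega


def T1 (z τ : ℂ) : ℂ := -Th (1/2) (z + 1/2) τ
def T2 (z τ : ℂ) : ℂ := Th (1/2) z τ
def T3 (z τ : ℂ) : ℂ := Th 0 z τ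
def T4 (z τ : ℂ) : ℂ := Th 0 (z + 1/2) τ

lemma Th0_add_one (z τ : ℂ) : Th 0 (z + 1) τ = Th 0 z τ := by
  rw [Th_add_one]; simp

lemma exp_half_aux : cexp (2 * Real.pi * I * ((1/2 : ℝ) : ℂ)) = -1 := by
  rw [show (2 * Real.pi * I * ((1/2 : ℝ) : ℂ)) = Real.pi * I by push_cast; ring]
  exact Complex.exp_pi_mul_I

lemma exp_quarter_aux : cexp (2 * Real.pi * I * ((1/4 : ℝ) : ℂ)) = I := by
  rw [show (2 * Real.pi * I * ((1/4 : ℝ) : ℂ)) = Real.pi / 2 * I by push_cast; ring]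
  exact Complex.exp_pi_div_two_mul_I

lemma exp_three_quarter_aux : cexp (2 * Real.pi * I * ((3/4 : ℝ) : ℂ)) = -I := by
  rw [show (2 * Real.pi * I * ((3/4 : ℝ) : ℂ)) = Real.pi * I + Real.pi / 2 * I by push_cast; ring,
    Complex.exp_add, Complex.exp_pi_div_two_mul_I, Complex.exp_pi_mul_I]
  ring

lemma Thh_add_one (z τ : ℂ) : Th (1/2) (z + 1) τ = -Th (1/2) z τ := by
  rw [Th_add_one, exp_half_aux]; ring

lemma Th0_neg (z τ : ℂ) : Th 0 (-z) τ = Th 0 z τ := by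
  have := Th_neg 0 z τ
  simpa using this

lemma Thh_neg (z τ : ℂ) : Th (1/2) (-z) τ = Th (1/2) z τ := by
  have h := Th_neg (1/2) z τ
  have h2 := Th_shift (-(1/2)) (-z) τ
  rw [← h, ← h2]; norm_num

lemma T2_neg (z τ : ℂ) : T2 (-z) τ = T2 z τ := Thh_neg z τ
lemma T3_neg (z τ : ℂ) : T3 (-z) τ = T3 z τ := Th0_neg z τ
lemma T4_neg (z τ : ℂ) : T4 (-z) τ = T4 z τ := by
  unfold T4
  rw [← Th0_neg, ← Th0_add_one]
  congr 1; ring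
lemma T1_neg (z τ : ℂ) : T1 (-z) τ = -T1 z τ := by
  unfold T1
  rw [← Thh_neg (-z + 1/2), show -(-z + 1/2 : ℂ) = z - 1/2 by ring,
    show (z + 1/2 : ℂ) = (z - 1/2) + 1 by ring, Thh_add_one]
  ring
lemma T1_zero (τ : ℂ) : T1 0 τ = 0 := by
  have := T1_neg 0 τ
  rw [neg_zero] at this
  linear_combination this / 2
lemma T2_add_one (z τ : ℂ) : T2 (z + 1) τ = -T2 z τ := Thh_add_one z τ
lemma T3_add_one (z τ : ℂ) : T3 (z + 1) τ = T3 z τ := Th0_add_one z τ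
lemma T1_add_one (z τ : ℂ) : T1 (z + 1) τ = -T1 z τ := by
  unfold T1
  rw [show (z + 1 + 1/2 : ℂ) = (z + 1/2) + 1 by ring, Thh_add_one]
lemma T4_add_one (z τ : ℂ) : T4 (z + 1) τ = T4 z τ := by
  unfold T4
  rw [show (z + 1 + 1/2 : ℂ) = (z + 1/2) + 1 by ring, Th0_add_one]
lemma T1_add_half (z τ : ℂ) : T1 (z + 1/2) τ = T2 z τ := by
  unfold T1 T2
  rw [show (z + 1/2 + 1/2 : ℂ) = z + 1 by ring, Thh_add_one, neg_neg]
lemma T2_add_half (z τ : ℂ) : T2 (z + 1/2) τ = -T1 z τ := by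
  unfold T1 T2
  rw [neg_neg]
lemma T3_add_half (z τ : ℂ) : T3 (z + 1/2) τ = T4 z τ := rfl
lemma T4_add_half (z τ : ℂ) : T4 (z + 1/2) τ = T3 z τ := by
  unfold T4 T3
  rw [show (z + 1/2 + 1/2 : ℂ) = z + 1 by ring, Th0_add_one]

lemma T3_sq (z : ℂ) {τ : ℂ} (hτ : 0 < τ.im) :
    T3 z τ ^ 2 = T3 (2*z) (2*τ) * T3 0 (2*τ) + T2 (2*z) (2*τ) * T2 0 (2*τ) := by
  have h := Th_mul 0 0 z z hτ
  unfold T3 T2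
  rw [sq, h]
  norm_num [two_mul z]

lemma T2_sq (z : ℂ) {τ : ℂ} (hτ : 0 < τ.im) :
    T2 z τ ^ 2 = T3 (2*z) (2*τ) * T2 0 (2*τ) + T2 (2*z) (2*τ) * T3 0 (2*τ) := by
  have h := Th_mul (1/2) (1/2) z z hτ
  have h1 := Th_shift 0 (z + z) (2 * τ)
  unfold T3 T2
  rw [sq, h, show ((1/2 + 1/2 + 1)/2 : ℝ) = 0 + 1 by norm_num, h1,
    show ((1/2 + 1/2)/2 : ℝ) = 1/2 by norm_num, show ((1/2 - 1/2)/2 : ℝ) = 0 by norm_num,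
    show ((1/2 - 1/2 + 1)/2 : ℝ) = 1/2 by norm_num, sub_self, two_mul z]
  ring

lemma T4_sq (z : ℂ) {τ : ℂ} (hτ : 0 < τ.im) :
    T4 z τ ^ 2 = T3 (2*z) (2*τ) * T3 0 (2*τ) - T2 (2*z) (2*τ) * T2 0 (2*τ) := by
  have h := T3_sq (z + 1/2) hτ
  rw [T3_add_half, show (2 * (z + 1/2) : ℂ) = 2 * z + 1 by ring, T3_add_one, T2_add_one] at h
  rw [h]; ring

lemma T1_sq (z : ℂ) {τ : ℂ} (hτ : 0 < τ.im) :
    T1 z τ ^ 2 = T3 (2*z) (2*τ) * T2 0 (2*τ) - T2 (2*z) (2*τ) * T3 0 (2*τ) := by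
  have h := T2_sq (z + 1/2) hτ
  rw [T2_add_half, show (2 * (z + 1/2) : ℂ) = 2 * z + 1 by ring, T3_add_one, T2_add_one] at h
  rw [neg_sq] at h
  rw [h]; ring

lemma T_quartic {τ : ℂ} (hτ : 0 < τ.im) : T3 0 τ ^ 4 = T2 0 τ ^ 4 + T4 0 τ ^ 4 := by
  have h3 := T3_sq 0 hτ
  have h2 := T2_sq 0 hτ
  have h4 := T4_sq 0 hτ
  rw [mul_zero] at h3 h2 h4
  rw [show T3 0 τ ^ 4 = (T3 0 τ ^ 2)^2 by ring, show T2 0 τ ^ 4 = (T2 0 τ ^ 2)^2 by ring,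
    show T4 0 τ ^ 4 = (T4 0 τ ^ 2)^2 by ring, h3, h2, h4]
  ring

/-- relation giving `sn² + cn² = 1` -/
lemma T_rel1 (z : ℂ) {τ : ℂ} (hτ : 0 < τ.im) :
    T3 0 τ ^ 2 * T1 z τ ^ 2 + T4 0 τ ^ 2 * T2 z τ ^ 2 = T2 0 τ ^ 2 * T4 z τ ^ 2 := by
  have h3 := T3_sq 0 hτ
  have h2 := T2_sq 0 hτ
  have h4 := T4_sq 0 hτ
  rw [mul_zero] at h3 h2 h4
  rw [h3, h2, h4, T1_sq z hτ, T2_sq z hτ, T4_sq z hτ]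
  ring

/-- relation giving `dn² + k² sn² = 1` -/
lemma T_rel2 (z : ℂ) {τ : ℂ} (hτ : 0 < τ.im) :
    T4 0 τ ^ 2 * T3 z τ ^ 2 + T2 0 τ ^ 2 * T1 z τ ^ 2 = T3 0 τ ^ 2 * T4 z τ ^ 2 := by
  have h3 := T3_sq 0 hτ
  have h2 := T2_sq 0 hτ
  have h4 := T4_sq 0 hτ
  rw [mul_zero] at h3 h2 h4
  rw [h3, h2, h4, T1_sq z hτ, T3_sq z hτ, T4_sq z hτ]
  ring

lemma T2_zero_sq {τ : ℂ} (hτ : 0 < τ.im) : T2 0 τ ^ 2 = 2 * T2 0 (2*τ) * T3 0 (2*τ) := by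
  rw [T2_sq 0 hτ, mul_zero]; ring

lemma T3_mul_T4_zero {τ : ℂ} (hτ : 0 < τ.im) : T3 0 τ * T4 0 τ = T4 0 (2*τ) ^ 2 := by
  have h := Th_mul 0 0 0 (1/2) hτ
  have h1 : Th (1/2) (1/2) (2*τ) = 0 := by
    have := T1_zero (2*τ)
    rw [T1, zero_add, neg_eq_zero] at this
    exact this
  have h2 := Th0_neg (1/2) (2*τ)
  unfold T3 T4
  rw [zero_add, h]
  norm_num at h1 h2 ⊢
  rw [h1, h2]
  ring

lemma T_dup (z : ℂ) {τ : ℂ} (hτ : 0 < τ.im) :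
    T1 (2*z) (2*τ) * T4 0 (2*τ) = T1 z τ * T2 z τ := by
  have h := Th_mul (1/2) (1/2) (z + 1/2) z hτ
  have h1 : Th (1/2) (1/2) (2*τ) = 0 := by
    have := T1_zero (2*τ)
    rw [T1, zero_add, neg_eq_zero] at this
    exact this
  unfold T1 T2 T4
  rw [neg_mul, neg_mul, h, show ((1/2 + 1/2)/2 : ℝ) = 1/2 by norm_num,
    show ((1/2 - 1/2)/2 : ℝ) = 0 by norm_num,
    show ((1/2 - 1/2 + 1)/2 : ℝ) = 1/2 by norm_num,
    show (z + 1/2 - z : ℂ) = 1/2 by ring, h1, show (z + 1/2 + z : ℂ) = 2*z+1/2 by ring]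
  rw [zero_add]; ring

lemma T23_mul (z y : ℂ) {τ : ℂ} (hτ : 0 < τ.im) :
    T2 (z+y) τ * T3 (z-y) τ = Th (1/4) (2*z) (2*τ) * Th (1/4) (2*y) (2*τ)
      + Th (3/4) (2*z) (2*τ) * Th (3/4) (2*y) (2*τ) := by
  have h := Th_mul (1/2) 0 (z+y) (z-y) hτ
  unfold T2 T3
  rw [h, show (z + y + (z - y) : ℂ) = 2 * z by ring, show (z + y - (z - y) : ℂ) = 2 * y by ring]
  norm_num

lemma T14_mul (z y : ℂ) {τ : ℂ} (hτ : 0 < τ.im) :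
    T1 (z+y) τ * T4 (z-y) τ = -I * (Th (1/4) (2*z) (2*τ) * Th (1/4) (2*y) (2*τ)
      - Th (3/4) (2*z) (2*τ) * Th (3/4) (2*y) (2*τ)) := by
  have h := T23_mul (z + 1/2) y hτ
  rw [show (z + 1/2 + y : ℂ) = z + y + 1/2 by ring, show (z + 1/2 - y : ℂ) = z - y + 1/2 by ring,
    T2_add_half, T3_add_half, show (2 * (z + 1/2) : ℂ) = 2 * z + 1 by ring, Th_add_one, Th_add_one,
    exp_quarter_aux, exp_three_quarter_aux] at h
  linear_combination -h

lemma T_addition (z y : ℂ) {τ : ℂ} (hτ : 0 < τ.im) :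
    T1 (z+y) τ * T4 (z-y) τ * (T2 0 τ * T3 0 τ)
      = T1 z τ * T4 z τ * (T2 y τ * T3 y τ) + T2 z τ * T3 z τ * (T1 y τ * T4 y τ) := by
  have e : Th (3/4) 0 (2*τ) = Th (1/4) 0 (2*τ) := by
    have h1 := Th_neg (1/4) 0 (2*τ)
    have h2 := Th_shift (-(1/4)) 0 (2*τ)
    rw [neg_zero] at h1
    rw [← h1, ← h2]; norm_num
  have a1 := T14_mul z y hτ
  have a2 := T23_mul 0 0 hτ
  have a3 := T14_mul z 0 hτ
  have a4 := T23_mul y 0 hτ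
  have a5 := T23_mul z 0 hτ
  have a6 := T14_mul y 0 hτ
  simp only [add_zero, sub_zero, mul_zero, e] at a2 a3 a4 a5 a6
  rw [a1, a2, a3, a4, a5, a6]
  ring


lemma Th_diff (α : ℝ) {τ : ℂ} (hτ : 0 < τ.im) : Differentiable ℂ (fun z => Th α z τ) := by
  intro z
  have h : (fun z => Th α z τ) = fun z => cexp (2 * Real.pi * I * α * z + Real.pi * I * α ^ 2 * τ)
        * jacobiTheta₂ (z + α * τ) τ := by
    funext z; exact Th_eq α z τ
  rw [h]
  have h2 : DifferentiableAt ℂ (fun z => jacobiTheta₂ (z + α * τ) τ) z :=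
    DifferentiableAt.comp (g := fun z => jacobiTheta₂ z τ) z
      (differentiableAt_jacobiTheta₂_fst (z + α * τ) hτ)
      (by fun_prop : DifferentiableAt ℂ (fun z : ℂ => z + α * τ) z)
  fun_prop

def T1d (z τ : ℂ) : ℂ := deriv (fun z => T1 z τ) z
def T2d (z τ : ℂ) : ℂ := deriv (fun z => T2 z τ) z
def T3d (z τ : ℂ) : ℂ := deriv (fun z => T3 z τ) z
def T4d (z τ : ℂ) : ℂ := deriv (fun z => T4 z τ) z

lemma T2_hasDerivAt (z : ℂ) {τ : ℂ} (hτ : 0 < τ.im) : HasDerivAt (fun z => T2 z τ) (T2d z τ) z :=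
  (Th_diff (1/2) hτ z).hasDerivAt
lemma T3_hasDerivAt (z : ℂ) {τ : ℂ} (hτ : 0 < τ.im) : HasDerivAt (fun z => T3 z τ) (T3d z τ) z :=
  (Th_diff 0 hτ z).hasDerivAt
lemma T4_hasDerivAt (z : ℂ) {τ : ℂ} (hτ : 0 < τ.im) : HasDerivAt (fun z => T4 z τ) (T4d z τ) z := by
  have h : DifferentiableAt ℂ (fun z => T4 z τ) z :=
    DifferentiableAt.comp (g := fun z => Th 0 z τ) z (Th_diff 0 hτ (z + 1/2))
      (by fun_prop : DifferentiableAt ℂ (fun z : ℂ => z + 1/2) z)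
  exact h.hasDerivAt
lemma T1_hasDerivAt (z : ℂ) {τ : ℂ} (hτ : 0 < τ.im) : HasDerivAt (fun z => T1 z τ) (T1d z τ) z := by
  have h : DifferentiableAt ℂ (fun z => T1 z τ) z :=
    (DifferentiableAt.comp (g := fun z => Th (1/2) z τ) z (Th_diff (1/2) hτ (z + 1/2))
      (by fun_prop : DifferentiableAt ℂ (fun z : ℂ => z + 1/2) z)).neg
  exact h.hasDerivAt

lemma T2d_zero {τ : ℂ} (hτ : 0 < τ.im) : T2d 0 τ = 0 := by
  have h := T2_hasDerivAt 0 hτ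
  have h1 : HasDerivAt (fun z => T2 (-z) τ) (T2d 0 τ * -1) 0 := by
    refine HasDerivAt.comp (h₂ := fun z => T2 z τ) (0:ℂ) ?_ (hasDerivAt_neg 0)
    simpa using h
  simp_rw [T2_neg] at h1
  have := h.unique h1
  linear_combination this / 2

lemma T3d_zero {τ : ℂ} (hτ : 0 < τ.im) : T3d 0 τ = 0 := by
  have h := T3_hasDerivAt 0 hτ
  have h1 : HasDerivAt (fun z => T3 (-z) τ) (T3d 0 τ * -1) 0 := by
    refine HasDerivAt.comp (h₂ := fun z => T3 z τ) (0:ℂ) ?_ (hasDerivAt_neg 0)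
    simpa using h
  simp_rw [T3_neg] at h1
  have := h.unique h1
  linear_combination this / 2

lemma T2d_eq (z : ℂ) {τ : ℂ} (hτ : 0 < τ.im) : T1d (z + 1/2) τ = T2d z τ := by
  have h := T1_hasDerivAt (z + 1/2) hτ
  have h1 : HasDerivAt (fun z => T1 (z + 1/2) τ) (T1d (z + 1/2) τ * 1) z :=
    HasDerivAt.comp (h₂ := fun z => T1 z τ) z h ((hasDerivAt_id z).add_const _)
  simp_rw [T1_add_half] at h1
  have := h1.unique (T2_hasDerivAt z hτ)
  linear_combination this

lemma T3d_eq (z : ℂ) {τ : ℂ} (hτ : 0 < τ.im) : T4d (z + 1/2) τ = T3d z τ := by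
  have h := T4_hasDerivAt (z + 1/2) hτ
  have h1 : HasDerivAt (fun z => T4 (z + 1/2) τ) (T4d (z + 1/2) τ * 1) z :=
    HasDerivAt.comp (h₂ := fun z => T4 z τ) z h ((hasDerivAt_id z).add_const _)
  simp_rw [T4_add_half] at h1
  have := h1.unique (T3_hasDerivAt z hτ)
  linear_combination this

lemma T_wron (z : ℂ) {τ : ℂ} (hτ : 0 < τ.im) :
    (T1d z τ * T4 z τ - T1 z τ * T4d z τ) * (T2 0 τ * T3 0 τ)
      = T2 z τ * T3 z τ * (T1d 0 τ * T4 0 τ) := by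
  have a1 : HasDerivAt (fun y => T1 (z + y) τ) (T1d z τ * 1) 0 := by
    refine HasDerivAt.comp (h₂ := fun z => T1 z τ) (0:ℂ) ?_ ((hasDerivAt_id (0:ℂ)).const_add z)
    simpa using T1_hasDerivAt z hτ
  have a4 : HasDerivAt (fun y => T4 (z - y) τ) (T4d z τ * -1) 0 := by
    refine HasDerivAt.comp (h₂ := fun z => T4 z τ) (0:ℂ) ?_ ((hasDerivAt_id (0:ℂ)).const_sub z)
    simpa using T4_hasDerivAt z hτ
  have hL := (a1.mul a4).mul_const (T2 0 τ * T3 0 τ)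
  have hR := (((T2_hasDerivAt 0 hτ).mul (T3_hasDerivAt 0 hτ)).const_mul (T1 z τ * T4 z τ)).add
    (((T1_hasDerivAt 0 hτ).mul (T4_hasDerivAt 0 hτ)).const_mul (T2 z τ * T3 z τ))
  have e : (fun y => T1 (z + y) τ * T4 (z - y) τ * (T2 0 τ * T3 0 τ)) =
     fun y => T1 z τ * T4 z τ * (T2 y τ * T3 y τ) + T2 z τ * T3 z τ * (T1 y τ * T4 y τ) := by
    funext y; exact T_addition z y hτ
  have hL' : HasDerivAt (fun y => T1 (z + y) τ * T4 (z - y) τ * (T2 0 τ * T3 0 τ)) _ 0 := hL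
  rw [e] at hL'
  have := hL'.unique hR
  simp only [T2d_zero hτ, T3d_zero hτ, T1_zero, add_zero, sub_zero] at this
  linear_combination this

lemma T1d_dup {τ : ℂ} (hτ : 0 < τ.im) : 2 * T1d 0 (2*τ) * T4 0 (2*τ) = T1d 0 τ * T2 0 τ := by
  have hτ2 : 0 < (2 * τ).im := by simpa using hτ
  have h1 : HasDerivAt (fun z => T1 (2*z) (2*τ)) (T1d 0 (2*τ) * (2*1)) 0 := by
    refine HasDerivAt.comp (h₂ := fun z => T1 z (2*τ)) (0:ℂ) ?_ ((hasDerivAt_id (0:ℂ)).const_mul 2)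
    simpa using T1_hasDerivAt 0 hτ2
  have hL : HasDerivAt (fun z => T1 (2*z) (2*τ) * T4 0 (2*τ)) _ 0 := h1.mul_const (T4 0 (2*τ))
  have e : (fun z => T1 (2*z) (2*τ) * T4 0 (2*τ)) = fun z => T1 z τ * T2 z τ := by
    funext z; exact T_dup z hτ
  rw [e] at hL
  have := hL.unique ((T1_hasDerivAt 0 hτ).mul (T2_hasDerivAt 0 hτ))
  rw [T1_zero] at this
  linear_combination this

lemma T1d_zero_eq {τ : ℂ} (hτ : 0 < τ.im) :
    T1d 0 τ = -I * cexp (Real.pi * I * τ / 4) * jacobiTheta₂' (1/2 + τ/2) τ := by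
  have hz : jacobiTheta₂ (1/2 + τ/2) τ = 0 := by
    have h := T1_zero τ
    rw [T1, Th_eq, neg_eq_zero, mul_eq_zero] at h
    rcases h with h | h
    · exact absurd h (Complex.exp_ne_zero _)
    · rw [← h]; congr 1; push_cast; ring
  have e : (fun z => T1 z τ) = fun z =>
      -(cexp (Real.pi * I * (z + 1/2) + Real.pi * I * τ / 4) * jacobiTheta₂ (z + (1/2 + τ/2)) τ) := by
    funext z
    rw [T1, Th_eq]
    congr 2
    · congr 1; push_cast; ring
    · congr 1; push_cast; ring
  have h2 : HasDerivAt (fun z => jacobiTheta₂ (z + (1/2 + τ/2)) τ)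
      (jacobiTheta₂' (1/2 + τ/2) τ * 1) 0 := by
    refine HasDerivAt.comp (h₂ := fun z => jacobiTheta₂ z τ) (0:ℂ) ?_ ((hasDerivAt_id (0:ℂ)).add_const _)
    simpa using hasDerivAt_jacobiTheta₂_fst (1/2 + τ/2) hτ
  have h1 : HasDerivAt (fun z => cexp (Real.pi * I * (z + 1/2) + Real.pi * I * τ / 4))
      (deriv (fun z => cexp (Real.pi * I * (z + 1/2) + Real.pi * I * τ / 4)) 0) 0 :=
    DifferentiableAt.hasDerivAt (by fun_prop)
  have h := (h1.mul h2).neg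
  have h' := T1_hasDerivAt 0 hτ
  rw [e] at h'
  have := h'.unique h
  rw [this, zero_add, zero_add, hz, Complex.exp_add,
    show (Real.pi * I * (1/2) : ℂ) = Real.pi / 2 * I by ring, Complex.exp_pi_div_two_mul_I]
  ring


def It (t : ℝ) : ℂ := I * (t : ℂ)

lemma It_im (t : ℝ) : (It t).im = t := by simp [It]

lemma cpow_half_aux {t : ℝ} (ht : 0 < t) : (-I * It t) ^ (1/2 : ℂ) = ((Real.sqrt t : ℝ) : ℂ) := by
  rw [show -I * It t = (t : ℂ) by rw [It, ← mul_assoc]; simp, Real.sqrt_eq_rpow,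
    Complex.ofReal_cpow ht.le]
  norm_num

lemma neg_inv_It {t : ℝ} (ht : 0 < t) : -1 / It t = It (1/t) := by
  have : (t : ℂ) ≠ 0 := by exact_mod_cast ht.ne'
  unfold It
  push_cast
  field_simp
  rw [Complex.I_sq]

lemma theta_pos_aux {t : ℝ} (ht : 0 < t) (x : ℝ) :
    ∃ r : ℝ, 0 < r ∧ jacobiTheta₂ (x / It t) (It (1/t)) = r := by
  have htc : (t : ℂ) ≠ 0 := by exact_mod_cast ht.ne'
  have him : 0 < (It (1/t)).im := by rw [It_im]; positivity
  have hs := hasSum_jacobiTheta₂_term (x / It t) him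
  have e : ∀ n : ℤ, jacobiTheta₂_term n (x / It t) (It (1/t))
      = ((Real.exp (2 * Real.pi * n * x / t - Real.pi * n ^ 2 / t) : ℝ) : ℂ) := by
    intro n
    rw [jacobiTheta₂_term, Complex.ofReal_exp]
    congr 1
    unfold It
    push_cast
    field_simp
    rw [Complex.I_sq]
    ring
  simp_rw [e] at hs
  have hre := Complex.hasSum_re hs
  simp only [Complex.ofReal_re] at hre
  refine ⟨(jacobiTheta₂ (x / It t) (It (1/t))).re, ?_, ?_⟩
  · rw [← hre.tsum_eq]
    exact hre.summable.tsum_pos (fun n => (Real.exp_pos _).le) 0 (Real.exp_pos _)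
  · have := Complex.hasSum_ofReal.2 hre
    exact hs.unique this

lemma T3_pos {t : ℝ} (ht : 0 < t) (x : ℝ) : ∃ r : ℝ, 0 < r ∧ T3 x (It t) = r := by
  obtain ⟨r, hr, h⟩ := theta_pos_aux ht x
  refine ⟨1 / Real.sqrt t * Real.exp (-Real.pi * x ^ 2 / t) * r, by positivity, ?_⟩
  have htc : (t : ℂ) ≠ 0 := by exact_mod_cast ht.ne'
  rw [T3, Th_eq]
  simp only [Complex.ofReal_zero, mul_zero, zero_mul, add_zero, ne_eq, OfNat.ofNat_ne_zero,
    not_false_eq_true, zero_pow, Complex.exp_zero, one_mul]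
  rw [jacobiTheta₂_functional_equation, cpow_half_aux ht, neg_inv_It ht, h]
  push_cast
  congr 3
  unfold It
  field_simp

lemma T3_inv {t : ℝ} (ht : 0 < t) : T3 0 (It (1/t)) = Real.sqrt t * T3 0 (It t) := by
  have hs : ((Real.sqrt t : ℝ) : ℂ) ≠ 0 := by exact_mod_cast (Real.sqrt_pos.2 ht).ne'
  rw [T3, Th_eq, T3, Th_eq]
  simp only [Complex.ofReal_zero, mul_zero, zero_mul, add_zero, ne_eq, OfNat.ofNat_ne_zero,
    not_false_eq_true, zero_pow, Complex.exp_zero, one_mul]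
  rw [jacobiTheta₂_functional_equation 0 (It t), cpow_half_aux ht, neg_inv_It ht]
  simp only [ne_eq, OfNat.ofNat_ne_zero,
    not_false_eq_true, zero_pow, mul_zero, zero_div, Complex.exp_zero, mul_one]
  field_simp

lemma T4_inv {t : ℝ} (ht : 0 < t) : T4 0 (It (1/t)) = Real.sqrt t * T2 0 (It t) := by
  have hs : ((Real.sqrt t : ℝ) : ℂ) ≠ 0 := by exact_mod_cast (Real.sqrt_pos.2 ht).ne'
  have htc : (t : ℂ) ≠ 0 := by exact_mod_cast ht.ne'
  rw [T4, Th_eq, T2, Th_eq]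
  simp only [Complex.ofReal_zero, mul_zero, zero_mul, add_zero, ne_eq, OfNat.ofNat_ne_zero,
    not_false_eq_true, zero_pow, Complex.exp_zero, one_mul]
  rw [jacobiTheta₂_functional_equation (0 + _) (It t), cpow_half_aux ht, neg_inv_It ht]
  have e1 : (0 + ((1/2 : ℝ) : ℂ) * It t) / It t = 0 + 1/2 := by
    unfold It; push_cast; field_simp; ring
  rw [e1]
  have e2 : cexp (0 + Real.pi * I * ((1/2 : ℝ) : ℂ) ^ 2 * It t) *
     cexp (-Real.pi * I * (0 + ((1/2 : ℝ) : ℂ) * It t) ^ 2 / It t) = 1 := by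
    rw [← Complex.exp_add, ← Complex.exp_zero]
    congr 1
    unfold It; push_cast; field_simp; ring
  generalize jacobiTheta₂ (0 + 1/2) (It (1/t)) = J at *
  generalize cexp (-Real.pi * I * (0 + ((1/2 : ℝ) : ℂ) * It t) ^ 2 / It t) = A at *
  rw [zero_add] at e2 ⊢
  generalize cexp (Real.pi * I * ((1/2 : ℝ) : ℂ) ^ 2 * It t) = B at *
  field_simp
  linear_combination -J * e2

lemma T4_pos {t : ℝ} (ht : 0 < t) (x : ℝ) : ∃ r : ℝ, 0 < r ∧ T4 x (It t) = r := by
  obtain ⟨r, hr, h⟩ := T3_pos ht (x + 1/2)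
  refine ⟨r, hr, ?_⟩
  rw [← h, ← T3_add_half]
  push_cast; rfl

lemma T2_pos {t : ℝ} (ht : 0 < t) : ∃ r : ℝ, 0 < r ∧ T2 0 (It t) = r := by
  obtain ⟨r, hr, h⟩ := T4_pos (one_div_pos.2 ht) 0
  have hs : ((Real.sqrt t : ℝ) : ℂ) ≠ 0 := by exact_mod_cast (Real.sqrt_pos.2 ht).ne'
  have h2 := T4_inv ht
  rw [Complex.ofReal_zero] at h
  refine ⟨r / Real.sqrt t, div_pos hr (Real.sqrt_pos.2 ht), ?_⟩
  rw [h] at h2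
  rw [Complex.ofReal_div, h2]
  field_simp

lemma T2_conj (t x : ℝ) : (starRingEnd ℂ) (T2 x (It t)) = T2 x (It t) := by
  rw [T2]
  conv_rhs => rw [← Thh_neg]
  unfold Th
  rw [conj_tsum]
  refine tsum_congr fun n => ?_
  rw [← Complex.exp_conj]
  congr 1
  have h2 : (starRingEnd ℂ) 2 = 2 := map_ofNat _ 2
  simp [It, h2]

lemma T2_real (t x : ℝ) : T2 x (It t) = ((T2 x (It t)).re : ℂ) :=
  (Complex.conj_eq_iff_re.1 (T2_conj t x)).symm
lemma T3_real {t : ℝ} (ht : 0 < t) (x : ℝ) : T3 x (It t) = ((T3 x (It t)).re : ℂ) := by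
  obtain ⟨r, _, h⟩ := T3_pos ht x
  rw [h, Complex.ofReal_re]
lemma T4_real {t : ℝ} (ht : 0 < t) (x : ℝ) : T4 x (It t) = ((T4 x (It t)).re : ℂ) := by
  obtain ⟨r, _, h⟩ := T4_pos ht x
  rw [h, Complex.ofReal_re]
lemma T1_real (t x : ℝ) : T1 x (It t) = ((T1 x (It t)).re : ℂ) := by
  have h := T2_real t (x + 1/2)
  have e : T1 x (It t) = -T2 ((x + 1/2 : ℝ) : ℂ) (It t) := by
    rw [show ((x + 1/2 : ℝ) : ℂ) = x + 1/2 by push_cast; rfl, T2_add_half, neg_neg]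
  rw [e, h]; simp


lemma lim_aux (f : ℤ → ℂ) (e : ℤ → ℝ) (he : ∀ n, 0 ≤ e n)
    (hs : Summable fun n => f n * ((Real.exp (-(Real.pi * e n)) : ℝ) : ℂ)) :
    Tendsto (fun t : ℝ => ∑' n, f n * ((Real.exp (-(Real.pi * e n) * t) : ℝ) : ℂ)) atTop
      (𝓝 (∑' n, if e n = 0 then f n else 0)) := by
  refine tendsto_tsum_of_dominated_convergence hs.norm ?_ ?_
  · intro n
    by_cases h : e n = 0
    · simp [h]
    · have hp : 0 < Real.pi * e n := mul_pos Real.pi_pos (lt_of_le_of_ne (he n) (Ne.symm h))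
      simp only [h, if_false]
      have h1 : Tendsto (fun t : ℝ => Real.exp (-(Real.pi * e n) * t)) atTop (𝓝 0) := by
        refine Real.tendsto_exp_atBot.comp ?_
        exact tendsto_id.const_mul_atTop_of_neg (by linarith)
      have h2 : Tendsto (fun t : ℝ => ((Real.exp (-(Real.pi * e n) * t) : ℝ) : ℂ)) atTop (𝓝 ((0:ℝ):ℂ)) :=
        (Complex.continuous_ofReal.tendsto 0).comp h1
      simpa using h2.const_mul (f n)
  · filter_upwards [eventually_ge_atTop (1:ℝ)] with t ht n
    rw [norm_mul, norm_mul, Complex.norm_real, Complex.norm_real, Real.norm_eq_abs, Real.norm_eq_abs,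
      Real.abs_exp, Real.abs_exp]
    have : 0 ≤ Real.pi * e n := mul_nonneg Real.pi_pos.le (he n)
    refine mul_le_mul_of_nonneg_left (Real.exp_le_exp.2 ?_) (norm_nonneg _)
    nlinarith

lemma nn_nonneg (n : ℤ) : (0:ℝ) ≤ (n:ℝ)^2 + n := by
  have : 0 ≤ n^2 + n := by
    rcases le_or_gt 0 n with h | h
    · positivity
    · nlinarith
  exact_mod_cast this

lemma nn_zero (n : ℤ) : ((n:ℝ)^2 + n = 0) ↔ n = 0 ∨ n = -1 := by
  have h1 : ((n:ℝ)^2 + n = 0) ↔ n^2 + n = 0 := by norm_cast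
  rw [h1, show n^2 + n = n * (n + 1) by ring, mul_eq_zero]
  omega

lemma tsum_two_aux (f : ℤ → ℂ) : ∑' n : ℤ, (if (n:ℝ)^2 + n = 0 then f n else 0) = f 0 + f (-1) := by
  rw [tsum_eq_sum (s := {0, -1})]
  · rw [Finset.sum_pair (by norm_num)]
    norm_num
  · intro n hn
    rw [if_neg]
    rw [nn_zero]
    simpa using hn

lemma tsum_one_aux (f : ℤ → ℂ) : ∑' n : ℤ, (if (n:ℝ)^2 = 0 then f n else 0) = f 0 := by
  rw [tsum_eq_single 0]
  · simp
  · intro n hn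
    rw [if_neg]
    positivity

lemma T3_lim : Tendsto (fun t : ℝ => T3 0 (It t)) atTop (𝓝 1) := by
  have e : ∀ (t : ℝ) (n : ℤ), cexp (2 * Real.pi * I * (n + (0:ℝ)) * 0 + Real.pi * I * (n + (0:ℝ)) ^ 2 * It t)
      = 1 * ((Real.exp (-(Real.pi * (n:ℝ)^2) * t) : ℝ) : ℂ) := by
    intro t n
    rw [one_mul, Complex.ofReal_exp]
    congr 1
    unfold It; push_cast
    linear_combination Real.pi * n^2 * t * Complex.I_sq
  have h := lim_aux (fun _ => 1) (fun n => (n:ℝ)^2) (fun n => sq_nonneg _) (by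
    have := (Th_hasSum 0 0 (τ := It 1) (by rw [It_im]; norm_num)).summable
    simp_rw [e] at this
    simpa using this)
  rw [tsum_one_aux] at h
  refine h.congr fun t => ?_
  rw [T3, Th]
  exact (tsum_congr (e t)).symm

lemma T4_lim : Tendsto (fun t : ℝ => T4 0 (It t)) atTop (𝓝 1) := by
  have e : ∀ (t : ℝ) (n : ℤ), cexp (2 * Real.pi * I * (n + (0:ℝ)) * (0 + 1/2) + Real.pi * I * (n + (0:ℝ)) ^ 2 * It t)
      = cexp (Real.pi * I * n) * ((Real.exp (-(Real.pi * (n:ℝ)^2) * t) : ℝ) : ℂ) := by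
    intro t n
    rw [Complex.ofReal_exp, ← Complex.exp_add]
    congr 1
    unfold It; push_cast
    linear_combination Real.pi * n^2 * t * Complex.I_sq
  have h := lim_aux (fun n => cexp (Real.pi * I * n)) (fun n => (n:ℝ)^2) (fun n => sq_nonneg _) (by
    have := (Th_hasSum 0 (0 + 1/2) (τ := It 1) (by rw [It_im]; norm_num)).summable
    simp_rw [e] at this
    simpa using this)
  rw [tsum_one_aux] at h
  rw [show cexp (Real.pi * I * (0:ℤ)) = 1 by simp] at h
  refine h.congr fun t => ?_
  rw [T4, Th]
  exact (tsum_congr (e t)).symm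

lemma jt_lim : Tendsto (fun t : ℝ => jacobiTheta₂ (It t / 2) (It t)) atTop (𝓝 2) := by
  have e : ∀ (t : ℝ) (n : ℤ), jacobiTheta₂_term n (It t / 2) (It t)
      = 1 * ((Real.exp (-(Real.pi * ((n:ℝ)^2 + n)) * t) : ℝ) : ℂ) := by
    intro t n
    rw [one_mul, Complex.ofReal_exp, jacobiTheta₂_term]
    congr 1
    unfold It; push_cast
    linear_combination Real.pi * (n^2 + n) * t * Complex.I_sq
  have h := lim_aux (fun _ => 1) (fun n => (n:ℝ)^2 + n) nn_nonneg (by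
    have := (hasSum_jacobiTheta₂_term (It 1 / 2) (τ := It 1) (by rw [It_im]; norm_num)).summable
    simp_rw [e] at this
    simpa using this)
  rw [tsum_two_aux] at h
  norm_num at h
  refine h.congr fun t => ?_
  rw [jacobiTheta₂]
  refine tsum_congr fun n => ?_
  rw [e]; simp

lemma jt'_lim : Tendsto (fun t : ℝ => jacobiTheta₂' (1/2 + It t / 2) (It t)) atTop
    (𝓝 (2 * Real.pi * I)) := by
  have e : ∀ (t : ℝ) (n : ℤ), jacobiTheta₂'_term n (1/2 + It t / 2) (It t)
      = (2 * Real.pi * I * n * cexp (Real.pi * I * n)) *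
        ((Real.exp (-(Real.pi * ((n:ℝ)^2 + n)) * t) : ℝ) : ℂ) := by
    intro t n
    rw [jacobiTheta₂'_term, mul_assoc (2 * Real.pi * I * n : ℂ), Complex.ofReal_exp,
      ← Complex.exp_add, jacobiTheta₂_term]
    congr 2
    unfold It; push_cast
    linear_combination Real.pi * (n^2 + n) * t * Complex.I_sq
  have h := lim_aux (fun n => 2 * Real.pi * I * n * cexp (Real.pi * I * n)) (fun n => (n:ℝ)^2 + n) nn_nonneg (by
    have := (hasSum_jacobiTheta₂'_term (1/2 + It 1 / 2) (τ := It 1) (by rw [It_im]; norm_num)).summable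
    simp_rw [e] at this
    simpa using this)
  rw [tsum_two_aux] at h
  have e2 : (2 * Real.pi * I * (0:ℤ) * cexp (Real.pi * I * (0:ℤ)) +
      2 * Real.pi * I * (-1:ℤ) * cexp (Real.pi * I * (-1:ℤ)) : ℂ) = 2 * Real.pi * I := by
    rw [show (Real.pi * I * (-1:ℤ) : ℂ) = -(Real.pi * I) by push_cast; ring, Complex.exp_neg,
      Complex.exp_pi_mul_I]
    push_cast
    norm_num
  rw [e2] at h
  refine h.congr fun t => ?_
  rw [jacobiTheta₂']
  exact (tsum_congr (e t)).symm

lemma T1d_lim : Tendsto (fun t : ℝ => T1d 0 (It t) / (T2 0 (It t) * T3 0 (It t) * T4 0 (It t)))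
    atTop (𝓝 (Real.pi : ℂ)) := by
  have h := ((jt'_lim.const_mul (-I)).div jt_lim (by norm_num)).div (T3_lim.mul T4_lim) (by norm_num)
  rw [show -I * (2 * Real.pi * I) / 2 / (1 * 1) = (Real.pi : ℂ) by
    linear_combination (-Real.pi : ℂ) * Complex.I_sq] at h
  refine h.congr' ?_
  filter_upwards [eventually_gt_atTop (0:ℝ)] with t ht
  have him : 0 < (It t).im := by rw [It_im]; exact ht
  rw [T1d_zero_eq him]
  have e : T2 0 (It t) = cexp (Real.pi * I * It t / 4) * jacobiTheta₂ (It t / 2) (It t) := by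
    rw [T2, Th_eq]
    congr 2
    · push_cast; ring
    · push_cast; ring
  rw [e]
  have := Complex.exp_ne_zero (Real.pi * I * It t / 4)
  simp only [Pi.div_apply]
  generalize cexp (Real.pi * I * It t / 4) = A at *
  rw [div_div, show -I * A * jacobiTheta₂' (1/2 + It t / 2) (It t) =
     A * (-I * jacobiTheta₂' (1/2 + It t / 2) (It t)) by ring,
     show A * jacobiTheta₂ (It t / 2) (It t) * T3 0 (It t) * T4 0 (It t) =
     A * (jacobiTheta₂ (It t / 2) (It t) * (T3 0 (It t) * T4 0 (It t))) by ring,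
     mul_div_mul_left _ _ this]

lemma T_ne {t : ℝ} (ht : 0 < t) : T2 0 (It t) ≠ 0 ∧ T3 0 (It t) ≠ 0 ∧ T4 0 (It t) ≠ 0 := by
  obtain ⟨a, ha, h2⟩ := T2_pos ht
  obtain ⟨b, hb, h3⟩ := T3_pos ht 0
  obtain ⟨c, hc, h4⟩ := T4_pos ht 0
  rw [Complex.ofReal_zero] at h3 h4
  rw [h2, h3, h4]
  refine ⟨?_, ?_, ?_⟩ <;> exact_mod_cast (by positivity)

lemma T1d_const_double {t : ℝ} (ht : 0 < t) :
    T1d 0 (It t) / (T2 0 (It t) * T3 0 (It t) * T4 0 (It t))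
    = T1d 0 (It (2*t)) / (T2 0 (It (2*t)) * T3 0 (It (2*t)) * T4 0 (It (2*t))) := by
  have him : 0 < (It t).im := by rw [It_im]; exact ht
  have e : It (2*t) = 2 * It t := by unfold It; push_cast; ring
  obtain ⟨a, b, c⟩ := T_ne ht
  obtain ⟨a', b', c'⟩ := T_ne (show 0 < 2 * t by linarith)
  rw [e] at a' b' c' ⊢
  have h1 := T1d_dup him
  have h2 := T2_zero_sq him
  have h3 := T3_mul_T4_zero him
  rw [div_eq_div_iff (by simp [a, b, c]) (by simp [a', b', c'])]
  have h4 : T2 0 (It t) * (2 * T4 0 (2 * It t)) ≠ 0 := by simp [a, c']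
  apply mul_left_cancel₀ h4
  generalize T1d 0 (It t) = D at *
  generalize T1d 0 (2 * It t) = D2 at *
  generalize T2 0 (It t) = x2 at *
  generalize T3 0 (It t) = x3 at *
  generalize T4 0 (It t) = x4 at *
  generalize T2 0 (2 * It t) = y2 at *
  generalize T3 0 (2 * It t) = y3 at *
  generalize T4 0 (2 * It t) = y4 at *
  linear_combination (-2 * y4 * y2 * y3 * y4) * h1 - 2 * D2 * y4 * (x3*x4) * h2 - 4 * D2 * y4 * y2*y3 * h3

lemma T1d_const {t : ℝ} (ht : 0 < t) :
    T1d 0 (It t) = Real.pi * (T2 0 (It t) * T3 0 (It t) * T4 0 (It t)) := by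
  have h : ∀ m : ℕ, T1d 0 (It t) / (T2 0 (It t) * T3 0 (It t) * T4 0 (It t))
    = T1d 0 (It (2^m*t)) / (T2 0 (It (2^m*t)) * T3 0 (It (2^m*t)) * T4 0 (It (2^m*t))) := by
    intro m
    induction m with
    | zero => simp
    | succ m ih =>
      rw [ih, T1d_const_double (by positivity), show (2 * (2^m * t) : ℝ) = 2^(m+1) * t by ring]
  have hl : Tendsto (fun m : ℕ => (2:ℝ)^m * t) atTop atTop :=
    (tendsto_pow_atTop_atTop_of_one_lt (by norm_num)).atTop_mul_const ht
  have h2 := T1d_lim.comp hl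
  have h3 : Tendsto (fun m : ℕ => T1d 0 (It t) / (T2 0 (It t) * T3 0 (It t) * T4 0 (It t)))
      atTop (𝓝 (Real.pi : ℂ)) := by
    refine h2.congr fun m => ?_
    exact (h m).symm
  have h4 := tendsto_nhds_unique h3 tendsto_const_nhds
  obtain ⟨a, b, c⟩ := T_ne ht
  rw [h4]
  field_simp


def a1 (t x : ℝ) : ℝ := (T1 x (It t)).re
def a2 (t x : ℝ) : ℝ := (T2 x (It t)).re
def a3 (t x : ℝ) : ℝ := (T3 x (It t)).re
def a4 (t x : ℝ) : ℝ := (T4 x (It t)).re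

lemma c1 (t x : ℝ) : T1 x (It t) = (a1 t x : ℂ) := T1_real t x
lemma c2 (t x : ℝ) : T2 x (It t) = (a2 t x : ℂ) := T2_real t x
lemma c3 {t : ℝ} (ht : 0 < t) (x : ℝ) : T3 x (It t) = (a3 t x : ℂ) := T3_real ht x
lemma c4 {t : ℝ} (ht : 0 < t) (x : ℝ) : T4 x (It t) = (a4 t x : ℂ) := T4_real ht x
lemma c20 (t : ℝ) : T2 0 (It t) = (a2 t 0 : ℂ) := by rw [← c2, Complex.ofReal_zero]
lemma c30 {t : ℝ} (ht : 0 < t) : T3 0 (It t) = (a3 t 0 : ℂ) := by rw [← c3 ht, Complex.ofReal_zero]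
lemma c40 {t : ℝ} (ht : 0 < t) : T4 0 (It t) = (a4 t 0 : ℂ) := by rw [← c4 ht, Complex.ofReal_zero]

lemma a3_pos {t : ℝ} (ht : 0 < t) (x : ℝ) : 0 < a3 t x := by
  obtain ⟨r, hr, h⟩ := T3_pos ht x
  rw [a3, h]; exact hr
lemma a4_pos {t : ℝ} (ht : 0 < t) (x : ℝ) : 0 < a4 t x := by
  obtain ⟨r, hr, h⟩ := T4_pos ht x
  rw [a4, h]; exact hr
lemma a20_pos {t : ℝ} (ht : 0 < t) : 0 < a2 t 0 := by
  obtain ⟨r, hr, h⟩ := T2_pos ht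
  rw [a2, Complex.ofReal_zero, h]; exact hr

lemma a_rel1 {t : ℝ} (ht : 0 < t) (x : ℝ) :
    a3 t 0 ^ 2 * a1 t x ^ 2 + a4 t 0 ^ 2 * a2 t x ^ 2 = a2 t 0 ^ 2 * a4 t x ^ 2 := by
  have h := T_rel1 x (τ := It t) (by rw [It_im]; exact ht)
  rw [c1, c2, c4 ht, c20, c30 ht, c40 ht] at h
  exact_mod_cast h
lemma a_rel2 {t : ℝ} (ht : 0 < t) (x : ℝ) :
    a4 t 0 ^ 2 * a3 t x ^ 2 + a2 t 0 ^ 2 * a1 t x ^ 2 = a3 t 0 ^ 2 * a4 t x ^ 2 := by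
  have h := T_rel2 x (τ := It t) (by rw [It_im]; exact ht)
  rw [c1, c3 ht, c4 ht, c20, c30 ht, c40 ht] at h
  exact_mod_cast h
lemma a_rel3 {t : ℝ} (ht : 0 < t) (x : ℝ) :
    a4 t 0 ^ 2 * a4 t x ^ 2 + a2 t 0 ^ 2 * a2 t x ^ 2 = a3 t 0 ^ 2 * a3 t x ^ 2 := by
  have h := T_rel2 (x + 1/2) (τ := It t) (by rw [It_im]; exact ht)
  rw [T1_add_half, T3_add_half, T4_add_half, c2, c3 ht, c4 ht, c20, c30 ht, c40 ht] at h
  exact_mod_cast h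
lemma a_quartic {t : ℝ} (ht : 0 < t) : a3 t 0 ^ 4 = a2 t 0 ^ 4 + a4 t 0 ^ 4 := by
  have h := T_quartic (τ := It t) (by rw [It_im]; exact ht)
  rw [c20, c30 ht, c40 ht] at h
  exact_mod_cast h

lemma a1_deriv {t : ℝ} (ht : 0 < t) (x : ℝ) : HasDerivAt (a1 t) (T1d x (It t)).re x :=
  (T1_hasDerivAt x (by rw [It_im]; exact ht)).real_of_complex
lemma a2_deriv {t : ℝ} (ht : 0 < t) (x : ℝ) : HasDerivAt (a2 t) (T2d x (It t)).re x :=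
  (T2_hasDerivAt x (by rw [It_im]; exact ht)).real_of_complex
lemma a3_deriv {t : ℝ} (ht : 0 < t) (x : ℝ) : HasDerivAt (a3 t) (T3d x (It t)).re x :=
  (T3_hasDerivAt x (by rw [It_im]; exact ht)).real_of_complex
lemma a4_deriv {t : ℝ} (ht : 0 < t) (x : ℝ) : HasDerivAt (a4 t) (T4d x (It t)).re x :=
  (T4_hasDerivAt x (by rw [It_im]; exact ht)).real_of_complex

lemma T_wron2 {t : ℝ} (ht : 0 < t) (z : ℂ) :
    T1d z (It t) * T4 z (It t) - T1 z (It t) * T4d z (It t)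
      = Real.pi * T4 0 (It t) ^ 2 * T2 z (It t) * T3 z (It t) := by
  have h := T_wron z (τ := It t) (by rw [It_im]; exact ht)
  obtain ⟨h2, h3, h4⟩ := T_ne ht
  rw [T1d_const ht] at h
  apply mul_right_cancel₀ (mul_ne_zero h2 h3)
  rw [h]; ring

lemma a_wron {t : ℝ} (ht : 0 < t) (x : ℝ) :
    (T1d x (It t)).re * a4 t x - a1 t x * (T4d x (It t)).re
      = Real.pi * a4 t 0 ^ 2 * a2 t x * a3 t x := by
  have h := congrArg Complex.re (T_wron2 ht x)
  rw [c1, c2, c3 ht, c4 ht, c40 ht, Complex.sub_re, Complex.re_mul_ofReal, Complex.re_ofReal_mul] at h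
  rw [h]
  norm_cast

lemma a_wron' {t : ℝ} (ht : 0 < t) (x : ℝ) :
    (T2d x (It t)).re * a3 t x - a2 t x * (T3d x (It t)).re
      = -(Real.pi * a4 t 0 ^ 2 * a1 t x * a4 t x) := by
  have him : 0 < (It t).im := by rw [It_im]; exact ht
  have h0 := T_wron2 ht (x + 1/2)
  rw [T2d_eq _ him, T3d_eq _ him, T1_add_half, T2_add_half, T3_add_half, T4_add_half] at h0
  have h := congrArg Complex.re h0
  rw [c1, c2, c3 ht, c4 ht, c40 ht, Complex.sub_re, Complex.re_mul_ofReal, Complex.re_ofReal_mul] at h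
  rw [h]
  norm_cast
  ring

def kk (t : ℝ) : ℝ := a2 t 0 ^ 2 / a3 t 0 ^ 2
def UU (t : ℝ) : ℝ := Real.pi / 2 * a3 t 0 ^ 2
def sn (t u : ℝ) : ℝ := a3 t 0 * a1 t (u / (Real.pi * a3 t 0 ^ 2)) / (a2 t 0 * a4 t (u / (Real.pi * a3 t 0 ^ 2)))
def cn (t u : ℝ) : ℝ := a4 t 0 * a2 t (u / (Real.pi * a3 t 0 ^ 2)) / (a2 t 0 * a4 t (u / (Real.pi * a3 t 0 ^ 2)))
def dn (t u : ℝ) : ℝ := a4 t 0 * a3 t (u / (Real.pi * a3 t 0 ^ 2)) / (a3 t 0 * a4 t (u / (Real.pi * a3 t 0 ^ 2)))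

lemma kk_pos {t : ℝ} (ht : 0 < t) : 0 < kk t := by
  have := a20_pos ht
  have := a3_pos ht 0
  unfold kk; positivity

lemma kk_lt {t : ℝ} (ht : 0 < t) : kk t < 1 := by
  have h2 := a20_pos ht
  have h3 := a3_pos ht 0
  have h4 := a4_pos ht 0
  have hq := a_quartic ht
  unfold kk
  rw [div_lt_one (by positivity)]
  have : (a2 t 0 ^ 2) ^ 2 < (a3 t 0 ^ 2) ^ 2 := by
    have : 0 < a4 t 0 ^ 4 := by positivity
    nlinarith
  exact lt_of_pow_lt_pow_left₀ 2 (by positivity) this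

lemma sn_cn {t : ℝ} (ht : 0 < t) (u : ℝ) : cn t u ^ 2 = 1 - sn t u ^ 2 := by
  have h2 := a20_pos ht
  have h3 := a3_pos ht 0
  have h4 := a4_pos ht (u / (Real.pi * a3 t 0 ^ 2))
  have h := a_rel1 ht (u / (Real.pi * a3 t 0 ^ 2))
  unfold cn sn
  generalize u / (Real.pi * a3 t 0 ^ 2) = x at *
  field_simp
  linear_combination h

lemma sn_dn {t : ℝ} (ht : 0 < t) (u : ℝ) : dn t u ^ 2 = 1 - kk t ^ 2 * sn t u ^ 2 := by
  have h2 := a20_pos ht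
  have h3 := a3_pos ht 0
  have h4 := a4_pos ht (u / (Real.pi * a3 t 0 ^ 2))
  have h := a_rel2 ht (u / (Real.pi * a3 t 0 ^ 2))
  unfold dn sn kk
  generalize u / (Real.pi * a3 t 0 ^ 2) = x at *
  field_simp
  linear_combination h

lemma dn_pos {t : ℝ} (ht : 0 < t) (u : ℝ) : 0 < dn t u := by
  have h3 := a3_pos ht 0
  have h4 := a4_pos ht 0
  have := a3_pos ht (u / (Real.pi * a3 t 0 ^ 2))
  have := a4_pos ht (u / (Real.pi * a3 t 0 ^ 2))
  unfold dn; positivity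

lemma sn_deriv {t : ℝ} (ht : 0 < t) (u : ℝ) : HasDerivAt (sn t) (cn t u * dn t u) u := by
  have h2 := a20_pos ht
  have h3 := a3_pos ht 0
  have h4 := a4_pos ht (u / (Real.pi * a3 t 0 ^ 2))
  have hp := Real.pi_pos
  have hw := a_wron ht (u / (Real.pi * a3 t 0 ^ 2))
  have hl : HasDerivAt (fun u : ℝ => u / (Real.pi * a3 t 0 ^ 2)) (1 / (Real.pi * a3 t 0 ^ 2)) u :=
    (hasDerivAt_id u).div_const _
  have d1 := (HasDerivAt.comp (h₂ := a1 t) u (a1_deriv ht _) hl).const_mul (a3 t 0)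
  have d4 := (HasDerivAt.comp (h₂ := a4 t) u (a4_deriv ht _) hl).const_mul (a2 t 0)
  have := d1.div d4 (by simp only [Function.comp]; positivity)
  refine HasDerivAt.congr_deriv this ?_
  simp only [Function.comp]
  unfold cn dn
  generalize u / (Real.pi * a3 t 0 ^ 2) = x at *
  generalize (T1d x (It t)).re = D1 at *
  generalize (T4d x (It t)).re = D4 at *
  field_simp
  linear_combination hw

lemma dn_deriv {t : ℝ} (ht : 0 < t) (u : ℝ) :
    HasDerivAt (dn t) (-(kk t ^ 2 * sn t u * cn t u)) u := by
  have h : HasDerivAt (fun u => Real.sqrt (1 - kk t ^ 2 * sn t u ^ 2))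
    (-(kk t ^ 2 * (2 * sn t u * (cn t u * dn t u))) / (2 * Real.sqrt (1 - kk t ^ 2 * sn t u ^ 2))) u := by
    have h1 : HasDerivAt (fun u => 1 - kk t ^ 2 * sn t u ^ 2)
        (-(kk t ^ 2 * (2 * sn t u * (cn t u * dn t u)))) u := by
      have := (((sn_deriv ht u).pow 2).const_mul (kk t ^ 2)).const_sub 1
      refine HasDerivAt.congr_deriv this ?_
      simp
    refine h1.sqrt ?_
    rw [← sn_dn ht]
    exact (pow_pos (dn_pos ht u) 2).ne'
  have e : (fun u => Real.sqrt (1 - kk t ^ 2 * sn t u ^ 2)) = dn t := by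
    funext v
    rw [← sn_dn ht, Real.sqrt_sq (dn_pos ht v).le]
  rw [e] at h
  refine h.congr_deriv ?_
  rw [← sn_dn ht, Real.sqrt_sq (dn_pos ht u).le]
  have := dn_pos ht u
  field_simp

lemma cn_deriv {t : ℝ} (ht : 0 < t) (u : ℝ) :
    HasDerivAt (cn t) (-(sn t u * dn t u)) u := by
  have h2 := a20_pos ht
  have h3 := a3_pos ht 0
  have h40 := a4_pos ht 0
  have h4 := a4_pos ht (u / (Real.pi * a3 t 0 ^ 2))
  have h3x := a3_pos ht (u / (Real.pi * a3 t 0 ^ 2))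
  have hp := Real.pi_pos
  have hw := a_wron' ht (u / (Real.pi * a3 t 0 ^ 2))
  have hl : HasDerivAt (fun u : ℝ => u / (Real.pi * a3 t 0 ^ 2)) (1 / (Real.pi * a3 t 0 ^ 2)) u :=
    (hasDerivAt_id u).div_const _
  have d1 := (HasDerivAt.comp (h₂ := a2 t) u (a2_deriv ht _) hl).const_mul (a3 t 0)
  have d4 := (HasDerivAt.comp (h₂ := a3 t) u (a3_deriv ht _) hl).const_mul (a2 t 0)
  have hcd := d1.div d4 (by simp only [Function.comp]; positivity)
  have hc := hcd.mul (dn_deriv ht u)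
  have e : cn t = ((fun x => a3 t 0 * (a2 t ∘ fun u => u / (Real.pi * a3 t 0 ^ 2)) x) /
      fun x => a2 t 0 * (a3 t ∘ fun u => u / (Real.pi * a3 t 0 ^ 2)) x) * dn t := by
    funext v
    have h4 := a4_pos ht (v / (Real.pi * a3 t 0 ^ 2))
    have h3x := a3_pos ht (v / (Real.pi * a3 t 0 ^ 2))
    simp only [Pi.mul_apply, Pi.div_apply, Function.comp, cn, dn]
    field_simp
  rw [e]
  refine hc.congr_deriv ?_
  have r3 := a_rel3 ht (u / (Real.pi * a3 t 0 ^ 2))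
  simp only [Pi.div_apply, Function.comp]
  unfold cn dn sn kk
  generalize u / (Real.pi * a3 t 0 ^ 2) = x at *
  generalize (T2d x (It t)).re = D2 at *
  generalize (T3d x (It t)).re = D3 at *
  have hw2 : D2 = (a2 t x * D3 -(Real.pi * a4 t 0 ^ 2 * a1 t x * a4 t x)) / a3 t x := by
    field_simp; linear_combination hw
  rw [hw2]
  field_simp
  linear_combination (-Real.pi * a1 t x) * r3

lemma a1_zero (t : ℝ) : a1 t 0 = 0 := by
  rw [a1, Complex.ofReal_zero, T1_zero, Complex.zero_re]

lemma isJac {t : ℝ} (ht : 0 < t) : IsJac (kk t) (sn t) (cn t) (dn t) where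
  ds := sn_deriv ht
  dc := cn_deriv ht
  dd := dn_deriv ht
  s0 := by simp [sn, a1_zero]
  c0 := by
    have h2 := a20_pos ht
    have h4 := a4_pos ht 0
    unfold cn; rw [zero_div]; field_simp
  d0 := by
    have h2 := a3_pos ht 0
    have h4 := a4_pos ht 0
    unfold dn; rw [zero_div]; field_simp
  sc := sn_cn ht
  sd := sn_dn ht
  dpos := dn_pos ht
  k0 := kk_pos ht
  k1 := kk_lt ht

lemma UU_pos {t : ℝ} (ht : 0 < t) : 0 < UU t := by
  have := a3_pos ht 0
  have := Real.pi_pos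
  unfold UU; positivity

lemma UU_arg {t : ℝ} (ht : 0 < t) : UU t / (Real.pi * a3 t 0 ^ 2) = 1/2 := by
  have := a3_pos ht 0
  have := Real.pi_pos
  unfold UU; field_simp

lemma cn_UU {t : ℝ} (ht : 0 < t) : cn t (UU t) = 0 := by
  have e : a2 t (1/2) = 0 := by
    have h := T2_add_half 0 (It t)
    rw [T1_zero, zero_add, neg_zero] at h
    rw [a2]; push_cast; rw [h, Complex.zero_re]
  rw [cn, UU_arg ht, e]; simp

lemma sn_UU {t : ℝ} (ht : 0 < t) : sn t (UU t) = 1 := by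
  have e : a1 t (1/2) = a2 t 0 := by
    have h := T1_add_half 0 (It t)
    rw [zero_add] at h
    rw [a1, a2]; push_cast; rw [h]
  have e' : a4 t (1/2) = a3 t 0 := by
    have h := T4_add_half 0 (It t)
    rw [zero_add] at h
    rw [a4, a3]; push_cast; rw [h]
  have := a3_pos ht 0
  have := a20_pos ht
  rw [sn, UU_arg ht, e, e']
  field_simp

lemma refl_arg {t : ℝ} (ht : 0 < t) (u : ℝ) :
    (2 * UU t - u) / (Real.pi * a3 t 0 ^ 2) = -(u / (Real.pi * a3 t 0 ^ 2)) + 1 := by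
  have := a3_pos ht 0
  have := Real.pi_pos
  unfold UU; field_simp; ring

lemma a1_refl (t x : ℝ) : a1 t (-x + 1) = a1 t x := by
  unfold a1; push_cast; rw [T1_add_one, T1_neg, neg_neg]
lemma a2_refl (t x : ℝ) : a2 t (-x + 1) = -a2 t x := by
  unfold a2; push_cast; rw [T2_add_one, T2_neg, Complex.neg_re]
lemma a3_refl (t x : ℝ) : a3 t (-x + 1) = a3 t x := by
  unfold a3; push_cast; rw [T3_add_one, T3_neg]
lemma a4_refl (t x : ℝ) : a4 t (-x + 1) = a4 t x := by
  unfold a4; push_cast; rw [T4_add_one, T4_neg]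

lemma sn_refl {t : ℝ} (ht : 0 < t) (u : ℝ) : sn t (2 * UU t - u) = sn t u := by
  unfold sn; rw [refl_arg ht, a1_refl, a4_refl]
lemma cn_refl {t : ℝ} (ht : 0 < t) (u : ℝ) : cn t (2 * UU t - u) = -cn t u := by
  unfold cn; rw [refl_arg ht, a2_refl, a4_refl]; ring
lemma dn_refl {t : ℝ} (ht : 0 < t) (u : ℝ) : dn t (2 * UU t - u) = dn t u := by
  unfold dn; rw [refl_arg ht, a3_refl, a4_refl]

/-- nonvanishing of theta2 on `(-1/2, 1/2)` -/
def NV (t : ℝ) : Prop := ∀ x : ℝ, |x| < 1/2 → a2 t x ≠ 0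

lemma a2_even (t x : ℝ) : a2 t (-x) = a2 t x := by
  unfold a2; push_cast; rw [T2_neg]

lemma NV_large : ∀ᶠ t in atTop, NV t := by
  have h1 : Tendsto (fun t : ℝ => a3 t 0 ^ 2) atTop (𝓝 (1 ^ 2)) := by
    have h := (Complex.continuous_re.tendsto _).comp T3_lim
    refine Tendsto.pow ?_ 2
    rw [Complex.one_re] at h
    refine h.congr fun t => ?_
    simp [a3]
  filter_upwards [h1.eventually_lt_const (show (1:ℝ)^2 < 5 by norm_num), eventually_gt_atTop 0]
    with t h5 ht
  have hU2 : UU t < 5 * Real.pi / 2 := by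
    have := Real.pi_pos
    unfold UU; nlinarith
  have key : ∀ x : ℝ, 0 ≤ x → x < 1/2 → a2 t x ≠ 0 := by
    intro x hx0 hx1 h0
    have hp : 0 < Real.pi * a3 t 0 ^ 2 := by
      have := a3_pos ht 0
      have := Real.pi_pos
      positivity
    have := (isJac ht).cpos_of_lt (UU_pos ht) (sn_UU ht) hU2 (u := x * (Real.pi * a3 t 0 ^ 2))
      (by positivity) (by unfold UU; nlinarith)
    rw [cn, mul_div_cancel_right₀ _ hp.ne', h0] at this
    simp at this
  intro x hx
  rcases le_total 0 x with h | h
  · exact key x h (by rwa [abs_of_nonneg h] at hx)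
  · rw [← a2_even]
    exact key (-x) (by linarith) (by rwa [abs_of_nonpos h] at hx)

lemma NV_descent {t : ℝ} (ht : 0 < t) (h : NV (2*t)) : NV t := by
  have key : ∀ x : ℝ, 0 ≤ x → x < 1/2 → a2 t x ≠ 0 := by
    intro x hx0 hx1 h0
    have hd := T_dup x (τ := It t) (by rw [It_im]; exact ht)
    rw [c2, h0, Complex.ofReal_zero, mul_zero] at hd
    have e : 2 * It t = It (2*t) := by unfold It; push_cast; ring
    rw [e] at hd
    rcases mul_eq_zero.1 hd with hd | hd
    · rcases hx0.eq_or_lt with hx | hx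
      · rw [← hx] at h0
        exact (a20_pos ht).ne' h0
      · have e2 : T2 ((2*x - 1/2 : ℝ) : ℂ) (It (2*t)) = 0 := by
          have := T1_add_half ((2*x - 1/2 : ℝ) : ℂ) (It (2*t))
          rw [← this, ← hd]; congr 1; push_cast; ring
        refine h (2*x - 1/2) ?_ ?_
        · rw [abs_lt]; constructor <;> linarith
        · rw [a2, e2, Complex.zero_re]
    · exact (T_ne (show 0 < 2*t by linarith)).2.2 hd
  intro x hx
  rcases le_total 0 x with h | h
  · exact key x h (by rwa [abs_of_nonneg h] at hx)
  · rw [← a2_even]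
    exact key (-x) (by linarith) (by rwa [abs_of_nonpos h] at hx)

lemma NV_all {t : ℝ} (ht : 0 < t) : NV t := by
  have hl : Tendsto (fun m : ℕ => (2:ℝ)^m * t) atTop atTop :=
    (tendsto_pow_atTop_atTop_of_one_lt (by norm_num)).atTop_mul_const ht
  obtain ⟨m, hm⟩ := (hl.eventually NV_large).exists
  have : ∀ m : ℕ, NV (2^m * t) → NV t := by
    intro m
    induction m with
    | zero => intro h; simpa using h
    | succ m ih =>
      intro h
      apply ih
      apply NV_descent (by positivity)
      rwa [show (2 * (2^m * t) : ℝ) = 2^(m+1) * t by ring]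
  exact this m hm

lemma cn_pos {t : ℝ} (ht : 0 < t) (u : ℝ) (h0 : 0 ≤ u) (h1 : u < UU t) : 0 < cn t u := by
  have h2 := a20_pos ht
  have h3 := a3_pos ht 0
  have h4 := a4_pos ht 0
  have hp := Real.pi_pos
  have hne : ∀ v, 0 ≤ v → v < UU t → cn t v ≠ 0 := by
    intro v hv0 hv1
    have h4' := a4_pos ht (v / (Real.pi * a3 t 0 ^ 2))
    have : a2 t (v / (Real.pi * a3 t 0 ^ 2)) ≠ 0 := by
      apply NV_all ht
      rw [abs_of_nonneg (by positivity), div_lt_iff₀ (by positivity)]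
      unfold UU at hv1; linarith
    unfold cn
    positivity
  by_contra hneg
  push Not at hneg
  have hcont : ContinuousOn (cn t) (Set.Icc 0 u) := fun v _ =>
    (cn_deriv ht v).continuousAt.continuousWithinAt
  have hc0 : cn t 0 = 1 := (isJac ht).c0
  have := intermediate_value_Icc' h0 hcont
  obtain ⟨v, hv, hv0⟩ := this (show (0:ℝ) ∈ Set.Icc (cn t u) (cn t 0) from ⟨hneg, by rw [hc0]; norm_num⟩)
  exact hne v hv.1 (lt_of_le_of_lt hv.2 h1) hv0


lemma ellK_kk {t : ℝ} (ht : 0 < t) : ellK (kk t) = UU t :=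
  (isJac ht).ellK_eq (UU_pos ht) (cn_UU ht) (cn_pos ht)

lemma ellE_kk {t : ℝ} (ht : 0 < t) : ellE (kk t) = IsJac.Ei (dn t) (UU t) :=
  (isJac ht).ellE_eq (UU_pos ht) (cn_UU ht) (cn_pos ht)

lemma a3_inv {t : ℝ} (ht : 0 < t) : a3 (1/t) 0 = Real.sqrt t * a3 t 0 := by
  have h := T3_inv ht
  rw [c30 ht, c30 (one_div_pos.2 ht)] at h
  exact_mod_cast h

lemma a2_inv {t : ℝ} (ht : 0 < t) : a2 (1/t) 0 = Real.sqrt t * a4 t 0 := by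
  have ht' := one_div_pos.2 ht
  have h := T4_inv ht'
  rw [one_div_one_div, c20, c40 ht] at h
  have h' : a4 t 0 = Real.sqrt (1/t) * a2 (1/t) 0 := by exact_mod_cast h
  rw [h', ← mul_assoc, ← Real.sqrt_mul ht.le, mul_one_div_cancel ht.ne', Real.sqrt_one, one_mul]

lemma UU_inv {t : ℝ} (ht : 0 < t) : UU (1/t) = t * UU t := by
  unfold UU
  rw [a3_inv ht, mul_pow, Real.sq_sqrt ht.le]; ring

lemma kk_inv {t : ℝ} (ht : 0 < t) : kk (1/t) = kprime (kk t) := by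
  have h3 := a3_pos ht 0
  have h4 := a4_pos ht 0
  have hq := a_quartic ht
  unfold kprime
  symm
  rw [Real.sqrt_eq_iff_mul_self_eq (by nlinarith [kk_pos ht, kk_lt ht]) (kk_pos (one_div_pos.2 ht)).le]
  unfold kk
  rw [a3_inv ht, a2_inv ht, mul_pow, mul_pow, Real.sq_sqrt ht.le]
  field_simp
  linear_combination hq

lemma ellK'_kk {t : ℝ} (ht : 0 < t) : ellK' (kk t) = t * ellK (kk t) := by
  rw [ellK', ← kk_inv ht, ellK_kk (one_div_pos.2 ht), ellK_kk ht, UU_inv ht]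

lemma ellK_integrand_cont {k : ℝ} (h0 : 0 ≤ k) (h1 : k < 1) :
    Continuous fun t => 1 / Real.sqrt (1 - k^2 * Real.sin t ^ 2) := by
  refine Continuous.div (by fun_prop) (by fun_prop) fun t => ?_
  exact (Real.sqrt_pos.2 (IsJac.one_sub_pos h0 h1 t)).ne'

lemma ellK_lt {k l : ℝ} (h0 : 0 ≤ k) (hkl : k < l) (h1 : l < 1) : ellK k < ellK l := by
  have hk1 : k < 1 := hkl.trans h1
  have hl0 : 0 ≤ l := h0.trans hkl.le
  have hsq : k ^ 2 < l ^ 2 := by nlinarith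
  have hp := Real.pi_pos
  refine intervalIntegral.integral_lt_integral_of_continuousOn_of_le_of_exists_lt (by positivity)
    (ellK_integrand_cont h0 hk1).continuousOn (ellK_integrand_cont hl0 h1).continuousOn ?_ ?_
  · intro x _
    refine one_div_le_one_div_of_le (Real.sqrt_pos.2 (IsJac.one_sub_pos hl0 h1 x)) ?_
    apply Real.sqrt_le_sqrt
    nlinarith [sq_nonneg (Real.sin x)]
  · refine ⟨Real.pi / 2, ⟨by positivity, le_refl _⟩, ?_⟩
    refine one_div_lt_one_div_of_lt (Real.sqrt_pos.2 (IsJac.one_sub_pos hl0 h1 _)) ?_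
    apply Real.sqrt_lt_sqrt (IsJac.one_sub_pos hl0 h1 _).le
    rw [Real.sin_pi_div_two]
    linarith

lemma ellK_zero : ellK 0 = Real.pi / 2 := by simp [ellK]
lemma ellE_zero : ellE 0 = Real.pi / 2 := by simp [ellE]

lemma ellK_pos {k : ℝ} (h0 : 0 < k) (h1 : k < 1) : 0 < ellK k := by
  have h := ellK_lt le_rfl h0 h1
  have hp := Real.pi_pos
  rw [ellK_zero] at h
  linarith

lemma kprime_mem {k : ℝ} (h0 : 0 < k) (h1 : k < 1) : 0 < kprime k ∧ kprime k < 1 := by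
  unfold kprime
  constructor
  · apply Real.sqrt_pos.2; nlinarith
  · rw [Real.sqrt_lt' one_pos]; nlinarith [pow_pos h0 2]

lemma kprime_lt {k l : ℝ} (h0 : 0 < k) (hkl : k < l) (h1 : l < 1) : kprime l < kprime k := by
  unfold kprime
  apply Real.sqrt_lt_sqrt <;> nlinarith

lemma ratio_lt {k l : ℝ} (h0 : 0 < k) (hkl : k < l) (h1 : l < 1) :
    ellK' l / ellK l < ellK' k / ellK k := by
  have hk1 : k < 1 := hkl.trans h1
  have hl0 : 0 < l := h0.trans hkl
  have A := ellK_lt h0.le hkl h1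
  have B : ellK' l < ellK' k :=
    ellK_lt (kprime_mem hl0 h1).1.le (kprime_lt h0 hkl h1) (kprime_mem h0 hk1).2
  have C : 0 < ellK' l := ellK_pos (kprime_mem hl0 h1).1 (kprime_mem hl0 h1).2
  have D := ellK_pos h0 hk1
  exact div_lt_div₀ B A.le (C.trans B).le D

lemma exists_t {k : ℝ} (h0 : 0 < k) (h1 : k < 1) : ∃ t : ℝ, 0 < t ∧ kk t = k ∧ ellTau k = It t := by
  have hK := ellK_pos h0 h1
  have hK' : 0 < ellK' k := ellK_pos (kprime_mem h0 h1).1 (kprime_mem h0 h1).2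
  have ht : 0 < ellK' k / ellK k := div_pos hK' hK
  refine ⟨ellK' k / ellK k, ht, ?_, ?_⟩
  · set t := ellK' k / ellK k with htd
    have e : ellK' (kk t) / ellK (kk t) = t := by
      have := ellK_pos (kk_pos ht) (kk_lt ht)
      rw [ellK'_kk ht]; field_simp
    rcases lt_trichotomy (kk t) k with h | h | h
    · have := ratio_lt (kk_pos ht) h h1
      rw [e] at this
      exact absurd this (lt_irrefl _)
    · exact h
    · have := ratio_lt h0 h (kk_lt ht)
      rw [e] at this
      exact absurd this (lt_irrefl _)
  · rw [ellTau, It]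
    push_cast
    ring

lemma theta1_eq (u : ℂ) (k : ℝ) : theta1 u k = T1 (u / Real.pi) (ellTau k) := by
  have hp : (Real.pi : ℂ) ≠ 0 := by exact_mod_cast Real.pi_pos.ne'
  rw [theta1, T1, Th_eq]
  have e : cexp (2 * Real.pi * I * ((1/2 : ℝ) : ℂ) * (u / Real.pi + 1/2)
      + Real.pi * I * ((1/2 : ℝ) : ℂ) ^ 2 * ellTau k) = I * cexp (Real.pi * I * ellTau k / 4 + I * u) := by
    rw [show (2 * Real.pi * I * ((1/2 : ℝ) : ℂ) * (u / Real.pi + 1/2)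
      + Real.pi * I * ((1/2 : ℝ) : ℂ) ^ 2 * ellTau k) =
        Real.pi / 2 * I + (Real.pi * I * ellTau k / 4 + I * u) by
        push_cast
        field_simp
        ring]
    rw [Complex.exp_add, Complex.exp_pi_div_two_mul_I]
  rw [e, show (u / Real.pi + 1/2 + ((1/2 : ℝ) : ℂ) * ellTau k : ℂ) = u / Real.pi + ellTau k / 2 + 1/2 by
    push_cast; ring]
  ring

lemma theta2_eq (u : ℂ) (k : ℝ) : theta2 u k = T2 (u / Real.pi) (ellTau k) := by
  have hp : (Real.pi : ℂ) ≠ 0 := by exact_mod_cast Real.pi_pos.ne'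
  rw [theta2, T2, Th_eq]
  congr 2
  · push_cast
    field_simp
    ring
  · push_cast; ring

lemma theta3_eq (u : ℂ) (k : ℝ) : theta3 u k = T3 (u / Real.pi) (ellTau k) := by
  rw [theta3, T3, Th_eq]; simp

lemma theta4_eq (u : ℂ) (k : ℝ) : theta4 u k = T4 (u / Real.pi) (ellTau k) := by
  rw [theta4, T4, Th_eq]; simp

lemma arg_eq {k t : ℝ} (ht : 0 < t) (hτ : ellTau k = It t) (u : ℝ) : (u : ℂ) / (theta3 0 k) ^ 2 / Real.pi = ((u / (Real.pi * a3 t 0 ^ 2) : ℝ) : ℂ) := by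
  rw [theta3_eq, hτ, zero_div, c30 ht]
  push_cast
  rw [div_div, mul_comm]

lemma snC_eq {k t : ℝ} (ht : 0 < t) (hτ : ellTau k = It t) (u : ℝ) : snC u k = (sn t u : ℂ) := by
  rw [snC, theta1_eq, theta4_eq, arg_eq ht hτ, theta3_eq, theta2_eq, hτ, zero_div, c1, c4 ht, c30 ht, c20, sn]
  push_cast; rfl

lemma cnC_eq {k t : ℝ} (ht : 0 < t) (hτ : ellTau k = It t) (u : ℝ) : cnC u k = (cn t u : ℂ) := by
  rw [cnC, theta2_eq (_ / _), theta4_eq (_ / _), arg_eq ht hτ, theta2_eq, theta4_eq, hτ, zero_div, c2, c4 ht, c40 ht, c20, cn]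
  push_cast; rfl

lemma dnC_eq {k t : ℝ} (ht : 0 < t) (hτ : ellTau k = It t) (u : ℝ) : dnC u k = (dn t u : ℂ) := by
  rw [dnC, theta3_eq (_ / _), theta4_eq (_ / _), arg_eq ht hτ, theta3_eq, theta4_eq, hτ, zero_div, c3 ht, c4 ht, c40 ht, c30 ht, dn]
  push_cast; rfl

lemma scC_eq {k t : ℝ} (ht : 0 < t) (hτ : ellTau k = It t) (u : ℝ) : scC u k = ((sn t u / cn t u : ℝ) : ℂ) := by
  rw [scC, snC_eq ht hτ, cnC_eq ht hτ]; push_cast; rfl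

lemma dcC_eq {k t : ℝ} (ht : 0 < t) (hτ : ellTau k = It t) (u : ℝ) : dcC u k = ((dn t u / cn t u : ℝ) : ℂ) := by
  rw [dcC, dnC_eq ht hτ, cnC_eq ht hτ]; push_cast; rfl

lemma DcInt_eq {k t : ℝ} (ht : 0 < t) (hτ : ellTau k = It t) (u : ℝ) : DcInt u k = ((∫ x in (0:ℝ)..u, (dn t x / cn t x) ^ 2 : ℝ) : ℂ) := by
  have e : ∀ x : ℝ, (u : ℂ) * (dcC ((x:ℂ) * u) k) ^ 2 = ((u * (dn t (x * u) / cn t (x * u)) ^ 2 : ℝ) : ℂ) := by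
    intro x
    rw [← Complex.ofReal_mul x u, dcC_eq ht hτ]
    push_cast; rfl
  rw [DcInt]
  simp_rw [e]
  rw [intervalIntegral.integral_ofReal, intervalIntegral.integral_const_mul]
  congr 1
  have := intervalIntegral.smul_integral_comp_mul_right (a := 0) (b := 1)
    (fun x => (dn t x / cn t x) ^ 2) u
  rw [smul_eq_mul, zero_mul, one_mul] at this
  exact this

lemma AJ_eq {k t : ℝ} (ht : 0 < t) (hτ : ellTau k = It t) (hk : kk t = k) {u : ℝ} (h0 : 0 ≤ u) (h1 : u < UU t) :
    AJ u k = (IsJac.AR k (UU t) (sn t) (cn t) (dn t) u : ℂ) := by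
  have hU := UU_pos ht
  rw [AJ, DcInt_eq ht hτ, (isJac ht).Dc_eq (cn_pos ht) h0 h1, ← hk, ellE_kk ht, ellK_kk ht, IsJac.AR]
  norm_cast
  congr 1
  field_simp
  ring

lemma ellK_one : ellK 1 = 0 := by
  rw [ellK]
  apply intervalIntegral.integral_undef
  have hp := Real.pi_pos
  refine not_intervalIntegrable_of_sub_inv_isBigO_punctured (c := Real.pi / 2) ?_ (by positivity)
    Set.right_mem_uIcc
  refine Asymptotics.IsBigO.of_bound 1 ?_
  have h1 : ∀ᶠ x in 𝓝[≠] (Real.pi / 2), x ∈ Set.Ioo 0 Real.pi :=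
    mem_nhdsWithin_of_mem_nhds (Ioo_mem_nhds (by positivity) (by linarith))
  filter_upwards [h1, self_mem_nhdsWithin] with x hx hne
  have hc : Real.sin (Real.pi / 2 - x) = Real.cos x := Real.sin_pi_div_two_sub x
  have hle : |Real.cos x| ≤ |x - Real.pi / 2| := by
    rw [← hc, abs_sub_comm]
    exact Real.abs_sin_le_abs
  have hnz : Real.cos x ≠ 0 := by
    rw [← hc]
    intro h
    rw [Real.sin_eq_zero_iff_of_lt_of_lt (by linarith [hx.1, hx.2]) (by linarith [hx.1, hx.2])] at h
    apply hne
    rw [Set.mem_singleton_iff]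
    linarith
  have e : Real.sqrt (1 - 1 ^ 2 * Real.sin x ^ 2) = |Real.cos x| := by
    rw [← Real.sqrt_sq_eq_abs, Real.cos_sq']
    congr 1; ring
  rw [e, one_mul, norm_inv, one_div, norm_inv, Real.norm_eq_abs, Real.norm_eq_abs, abs_abs]
  exact inv_anti₀ (abs_pos.2 hnz) hle

lemma ellTau_zero : ellTau 0 = 0 := by
  have : kprime 0 = 1 := by simp [kprime]
  rw [ellTau, ellK', this, ellK_one]; simp

lemma scC_zero (u : ℂ) : scC u 0 = 0 := by
  have h : ∀ z, jacobiTheta₂ z 0 = 0 := fun z => jacobiTheta₂_undef z (by simp)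
  rw [scC, snC, theta3, ellTau_zero, h]; simp

lemma dcC_zero (u : ℂ) : dcC u 0 = 0 := by
  have h : ∀ z, jacobiTheta₂ z 0 = 0 := fun z => jacobiTheta₂_undef z (by simp)
  rw [dcC, dnC, theta4, ellTau_zero, h]; simp

lemma AJ_zero (u : ℂ) : AJ u 0 = 0 := by
  rw [AJ, DcInt, ellE_zero, ellK_zero]
  simp [dcC_zero]

/-- additive form of (ii), for moduli in `(0,1)` -/
lemma AJ_add {k : ℝ} (h0 : 0 < k) (h1 : k < 1) {u v : ℝ} (hu : 0 < u) (hv : 0 < v)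
    (huv : u + v < ellK k) :
    AJ u k + AJ v k - AJ ((u + v : ℝ) : ℂ) k
      = -((kprime k : ℂ) * scC u k * scC v k * scC ((u + v : ℝ) : ℂ) k) := by
  obtain ⟨t, ht, hk, hτ⟩ := exists_t h0 h1
  have hU : ellK k = UU t := by rw [← hk, ellK_kk ht]
  rw [hU] at huv
  have huv0 : 0 < u + v := add_pos hu hv
  have hJ := isJac ht
  rw [hk] at hJ
  rw [AJ_eq ht hτ hk hu.le (by linarith), AJ_eq ht hτ hk hv.le (by linarith),
    AJ_eq ht hτ hk huv0.le huv, scC_eq ht hτ, scC_eq ht hτ, scC_eq ht hτ]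
  exact_mod_cast hJ.AR_add (UU t) u v (cn_pos ht u hu.le (by linarith)).ne'
    (cn_pos ht v hv.le (by linarith)).ne' (cn_pos ht _ huv0.le huv).ne'

lemma AJ_sum {k : ℝ} (h0 : 0 < k) (h1 : k < 1) {u v w : ℝ} (hu : u ∈ Set.Ioo 0 (ellK k))
    (hv : v ∈ Set.Ioo 0 (ellK k)) (hw : w ∈ Set.Ioo 0 (ellK k)) (hs : u + v + w = 2 * ellK k) :
    (kprime k : ℂ) * scC u k * scC v k * scC w k = AJ u k + AJ v k + AJ w k := by
  obtain ⟨t, ht, hk, hτ⟩ := exists_t h0 h1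
  have hU : ellK k = UU t := by rw [← hk, ellK_kk ht]
  rw [hU] at hu hv hw hs
  have hJ := isJac ht
  rw [hk] at hJ
  have hw' : w = 2 * UU t - (u + v) := by linarith
  have hs1 : sn t w = sn t (u + v) := by rw [hw', sn_refl ht]
  have hc1 : cn t w = -cn t (u + v) := by rw [hw', cn_refl ht]
  have hA : IsJac.AR k (UU t) (sn t) (cn t) (dn t) w = -IsJac.AR k (UU t) (sn t) (cn t) (dn t) (u + v) := by
    rw [hw']
    exact hJ.AR_refl (UU_pos ht).ne' (sn_refl ht) (cn_refl ht) (dn_refl ht) _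
  have hcw := cn_pos ht w hw.1.le hw.2
  have hcuv : cn t (u + v) ≠ 0 := by
    intro h; rw [hc1, h] at hcw; simp at hcw
  have h := hJ.AR_add (UU t) u v (cn_pos ht u hu.1.le hu.2).ne' (cn_pos ht v hv.1.le hv.2).ne' hcuv
  rw [AJ_eq ht hτ hk hu.1.le hu.2, AJ_eq ht hτ hk hv.1.le hv.2, AJ_eq ht hτ hk hw.1.le hw.2,
    scC_eq ht hτ, scC_eq ht hτ, scC_eq ht hτ]
  norm_cast
  rw [hA, hs1, hc1, div_neg]
  linear_combination -h

/-- **Star-triangle identities for the weights** (Lemma C.1 of the paper).  Let `k ∈ [0,1)`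
and `θ₁, θ₂, θ₃ ∈ (0,K)` with `θ₁ + θ₂ + θ₃ = 2K`.  Then
(i) `k'·sc(θ₁)·sc(θ₂)·sc(θ₃) = A(θ₁) + A(θ₂) + A(θ₃)`; equivalently, with
`m²₀ = Σ (A(θ_ℓ) - sc(θ_ℓ))`, `k'·Π sc(θ_ℓ) = m²₀ + Σ sc(θ_ℓ)`;
(ii) for `{i,j,l} = {1,2,3}`,
`[A(K-θᵢ) - sc(K-θᵢ)] + [A(K-θⱼ) - sc(K-θⱼ)] - [A(θ_l) - sc(θ_l)]
  = sc(θ_l) - sc(K-θᵢ) - sc(K-θⱼ) - k'·sc(K-θᵢ)·sc(K-θⱼ)·sc(θ_l)`. -/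
theorem star_triangle_weight_identities (k : ℝ) (hk : k ∈ Set.Ico (0:ℝ) 1)
    (θ : Fin 3 → ℝ) (hθ : ∀ i, θ i ∈ Set.Ioo 0 (ellK k))
    (hsum : θ 0 + θ 1 + θ 2 = 2 * ellK k) :
    ((kprime k : ℂ) * scC ((θ 0 : ℝ) : ℂ) k * scC ((θ 1 : ℝ) : ℂ) k * scC ((θ 2 : ℝ) : ℂ) k
        = AJ ((θ 0 : ℝ) : ℂ) k + AJ ((θ 1 : ℝ) : ℂ) k + AJ ((θ 2 : ℝ) : ℂ) k) ∧
    ((kprime k : ℂ) * ∏ i, scC ((θ i : ℝ) : ℂ) k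
        = (∑ i, (AJ ((θ i : ℝ) : ℂ) k - scC ((θ i : ℝ) : ℂ) k))
          + ∑ i, scC ((θ i : ℝ) : ℂ) k) ∧
    (∀ i j l : Fin 3, i ≠ j → j ≠ l → i ≠ l →
      (AJ ((ellK k - θ i : ℝ) : ℂ) k - scC ((ellK k - θ i : ℝ) : ℂ) k)
        + (AJ ((ellK k - θ j : ℝ) : ℂ) k - scC ((ellK k - θ j : ℝ) : ℂ) k)
        - (AJ ((θ l : ℝ) : ℂ) k - scC ((θ l : ℝ) : ℂ) k)
      = scC ((θ l : ℝ) : ℂ) k - scC ((ellK k - θ i : ℝ) : ℂ) k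
        - scC ((ellK k - θ j : ℝ) : ℂ) k
        - (kprime k : ℂ) * scC ((ellK k - θ i : ℝ) : ℂ) k
          * scC ((ellK k - θ j : ℝ) : ℂ) k * scC ((θ l : ℝ) : ℂ) k) := by
  rcases hk.1.eq_or_lt with h0 | h0
  · subst h0
    simp only [scC_zero, AJ_zero]
    simp
  · have h1 := hk.2
    have e1 := AJ_sum h0 h1 (hθ 0) (hθ 1) (hθ 2) hsum
    refine ⟨e1, ?_, ?_⟩
    · rw [Fin.prod_univ_three, Fin.sum_univ_three, Fin.sum_univ_three]
      linear_combination e1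
    · intro i j l hij hjl hil
      have hs : θ i + θ j + θ l = 2 * ellK k := by
        fin_cases i <;> fin_cases j <;> fin_cases l <;> simp_all <;> linarith
      have hsl : (ellK k - θ i) + (ellK k - θ j) = θ l := by linarith
      have e2 := AJ_add h0 h1 (u := ellK k - θ i) (v := ellK k - θ j)
        (by linarith [(hθ i).2]) (by linarith [(hθ j).2]) (by rw [hsl]; exact (hθ l).2)
      rw [hsl] at e2
      linear_combination e2
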